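/- arXiv:2207.09244 — 4 statements merged into one kernel-verified Lean document; each statement's English description precedes it below -/
import Mathlib

section
/- Let κ be a regular cardinal and let C be a locally κ-presentable category. Then there exists a regular cardinal π ≥ κ such that for every regular cardinal μ ≥ π, every μ-pure morphism f : A → B in C is a μ-filtered colimit of split morphisms in the arrow category of C: there exist a μ-filtered category J and a functor F : J → Arrow(C) such that every morphism F(j) admits a retraction (i.e., is split) and f is a colimit of F in Arrow(C). -/
/-!
STATEMENT 2: Let κ be a regular cardinal and C locally κ-presentable. Then there is a
regular cardinal π ≥ κ such that for every regular cardinal μ ≥ π, every μ-pure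
morphism f : A → B in C is a μ-filtered colimit, in the arrow category of C, of
morphisms that admit a retraction (split morphisms).
-/

universe v u

open CategoryTheory CategoryTheory.Limits Opposite

namespace Reflection

def IsCardinalFiltered (J : Type u₂) [Category.{v₂} J] (κ : Cardinal.{v}) : Prop :=
  ∀ (A : Type v) [SmallCategory A],
    Cardinal.mk (Σ (a : A) (b : A), a ⟶ b) < κ →
      ∀ F : A ⥤ J, Nonempty (Cocone F)

variable {C : Type u} [Category.{v} C]

def IsPresentableObj (κ : Cardinal.{v}) (X : C) : Prop :=
  ∀ (J : Type v) [SmallCategory J], IsCardinalFiltered J κ →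
    ∀ (F : J ⥤ C) (c : Cocone F), IsColimit c →
      Nonempty (IsColimit ((coyoneda.obj (op X)).mapCocone c))

def IsLocallyPresentable (C : Type u) [Category.{v} C] (κ : Cardinal.{v}) : Prop :=
  HasColimitsOfSize.{v, v} C ∧
    ∃ S : Set C, Small.{v} S ∧ (∀ X ∈ S, IsPresentableObj κ X) ∧
      ∀ X : C, ∃ (J : Type v) (_ : SmallCategory J) (F : J ⥤ C) (c : Cocone F),
        IsCardinalFiltered J κ ∧ (∀ j, F.obj j ∈ S) ∧
          Nonempty (IsColimit c) ∧ Nonempty (c.pt ≅ X)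

/-- A morphism `f : A ⟶ B` is `μ`-pure if every commutative square over it with
`μ`-presentable corners `A'`, `B'` admits a diagonal lift `B' ⟶ A` on the source side. -/
def IsPure (μ : Cardinal.{v}) {A B : C} (f : A ⟶ B) : Prop :=
  ∀ ⦃A' B' : C⦄ (f' : A' ⟶ B') (u : A' ⟶ A) (v : B' ⟶ B),
    IsPresentableObj μ A' → IsPresentableObj μ B' →
      u ≫ f = f' ≫ v → ∃ ub : B' ⟶ A, f' ≫ ub = u

lemma isCardinalFiltered_iff (J : Type u₂) [Category.{v₂} J] (κ : Cardinal.{v})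
    [Fact κ.IsRegular] :
    IsCardinalFiltered J κ ↔ CategoryTheory.IsCardinalFiltered J κ := by
  have key (A : Type v) [SmallCategory A] :
      HasCardinalLT (Arrow A) κ ↔
        Cardinal.mk (Σ (a : A) (b : A), a ⟶ b) < κ := by
    let e : Arrow A ≃ Σ (a : A) (b : A), a ⟶ b :=
      { toFun g := ⟨g.left, g.right, g.hom⟩
        invFun g := Arrow.mk g.2.2 }
    rw [hasCardinalLT_iff_of_equiv e, hasCardinalLT_iff_cardinal_mk_lt]
  exact ⟨fun h ↦ ⟨fun F hA ↦ h _ ((key _).1 hA) F⟩,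
    fun h A _ hA F ↦ h.nonempty_cocone F ((key A).2 hA)⟩

lemma isPresentableObj_iff (κ : Cardinal.{v}) [Fact κ.IsRegular] (X : C) :
    IsPresentableObj κ X ↔ IsCardinalPresentable X κ := by
  refine ⟨fun h ↦ ⟨fun J _ _ ↦ ⟨fun {F} ↦ ⟨fun {c} hc ↦ ?_⟩⟩⟩, fun h J _ hJ F c hc ↦ ?_⟩
  · exact h J ((isCardinalFiltered_iff J κ).2 inferInstance) F c hc
  · have := (isCardinalFiltered_iff J κ).1 hJ
    have := preservesColimitsOfShape_of_isCardinalPresentable X κ J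
    exact ⟨isColimitOfPreserves _ hc⟩

lemma IsLocallyPresentable.exists_isStrongGenerator {κ : Cardinal.{v}} [Fact κ.IsRegular]
    (hC : IsLocallyPresentable C κ) :
    ∃ (P : ObjectProperty C) (_ : ObjectProperty.Small.{v} P), P.IsStrongGenerator ∧
      P ≤ isCardinalPresentable C κ := by
  obtain ⟨-, S, hS, hS', h⟩ := hC
  refine ⟨(· ∈ S), hS, .mk_of_exists_colimitsOfShape.{v} fun X ↦ ?_,
    fun X hX ↦ (isPresentableObj_iff κ X).1 (hS' X hX)⟩
  obtain ⟨J, _, F, c, -, hF, ⟨hc⟩, ⟨e⟩⟩ := h X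
  exact ⟨J, inferInstance, (ObjectProperty.prop_iff_of_iso _ e).1 ⟨⟨⟨F, c.ι, hc⟩, hF⟩⟩⟩

variable (C) in
/-- The functor sending `X` to the identity arrow of `X`. -/
def idArrow : C ⥤ Arrow C where
  obj X := Arrow.mk (𝟙 X)
  map g := Arrow.homMk g g

variable (C) in
/-- The functor sending `X` to the arrow from the initial object to `X`. -/
noncomputable def initialArrow [HasInitial C] : C ⥤ Arrow C where
  obj X := Arrow.mk (initial.to X)
  map g := Arrow.homMk (𝟙 _) g

/-- The morphism from an identity arrow corresponding to a morphism to the source. -/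
abbrev homOfLeft {X : C} {g : Arrow C} (a : X ⟶ g.left) : (idArrow C).obj X ⟶ g :=
  Arrow.homMk a (a ≫ g.hom) (Category.id_comp _).symm

/-- The morphism from an arrow out of the initial object corresponding to a morphism
to the target. -/
noncomputable abbrev homOfRight [HasInitial C] {X : C} {g : Arrow C} (a : X ⟶ g.right) :
    (initialArrow C).obj X ⟶ g :=
  Arrow.homMk (initial.to _) a (initialIsInitial.hom_ext _ _)

variable (C) in
/-- Identity arrows are left adjoint to the source functor. -/
def idArrowAdjunction : idArrow C ⊣ Arrow.leftFunc :=
  Adjunction.mkOfHomEquiv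
    { homEquiv X g :=
        { toFun φ := φ.left
          invFun a := homOfLeft a
          left_inv φ := by
            ext
            · rfl
            · exact (Arrow.w φ).trans (Category.id_comp _)
          right_inv a := rfl }
      homEquiv_naturality_left_symm _ _ := by
        ext
        · rfl
        · exact Category.assoc _ _ _ }

variable (C) in
/-- Arrows out of the initial object are left adjoint to the target functor. -/
noncomputable def initialArrowAdjunction [HasInitial C] : initialArrow C ⊣ Arrow.rightFunc :=
  Adjunction.mkOfHomEquiv
    { homEquiv X g :=
        { toFun φ := φ.right
          invFun a := homOfRight a
          left_inv φ := by
            ext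
            · exact initialIsInitial.hom_ext _ _
            · rfl
          right_inv a := rfl }
      homEquiv_naturality_left_symm _ _ := by
        ext
        · exact initialIsInitial.hom_ext _ _
        · rfl }

/-- Arrows whose source and target are `μ`-presentable. -/
abbrev presentableEnds (C : Type u) [Category.{v} C] (μ : Cardinal.{v}) [Fact μ.IsRegular] :
    ObjectProperty (Arrow C) :=
  (isCardinalPresentable C μ).inverseImage Arrow.leftFunc ⊓
    (isCardinalPresentable C μ).inverseImage Arrow.rightFunc

/-- The identities of objects in `P`, and the arrows from the initial object to them. -/
abbrev arrowGenerator [HasInitial C] (P : ObjectProperty C) : ObjectProperty (Arrow C) :=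
  P.strictMap (idArrow C) ⊔ P.strictMap (initialArrow C)

lemma isStrongGenerator_arrowGenerator [HasInitial C] {P : ObjectProperty C}
    (hP : P.IsStrongGenerator) : (arrowGenerator P).IsStrongGenerator := by
  rw [ObjectProperty.isStrongGenerator_iff]
  have hid {X : C} (hX : P X) : arrowGenerator P ((idArrow C).obj X) := Or.inl ⟨X, hX⟩
  have hini {X : C} (hX : P X) : arrowGenerator P ((initialArrow C).obj X) := Or.inr ⟨X, hX⟩
  refine ⟨fun f g a b h ↦ ?_, fun f g i _ hi ↦ ?_⟩
  · ext
    · refine hP.isSeparating _ _ fun G hG x ↦ ?_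
      have := congr_arg (·.left) (h _ (hid hG) (homOfLeft x))
      exact this
    · refine hP.isSeparating _ _ fun G hG x ↦ ?_
      have := congr_arg (·.right) (h _ (hini hG) (homOfRight x))
      exact this
  · have := (idArrowAdjunction C).isRightAdjoint
    have := (initialArrowAdjunction C).isRightAdjoint
    have hl : IsIso i.left := by
      have : Mono i.left := inferInstanceAs (Mono (Arrow.leftFunc.map i))
      refine hP.isIso_of_mono _ fun G hG x ↦ ?_
      obtain ⟨y, hy⟩ := hi _ (hid hG) (homOfLeft x)
      exact ⟨y.left, congr_arg (·.left) hy⟩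
    have hr : IsIso i.right := by
      have : Mono i.right := inferInstanceAs (Mono (Arrow.rightFunc.map i))
      refine hP.isIso_of_mono _ fun G hG x ↦ ?_
      obtain ⟨y, hy⟩ := hi _ (hini hG) (homOfRight x)
      exact ⟨y.right, congr_arg (·.right) hy⟩
    exact Arrow.isIso_of_isIso_left_of_isIso_right i

lemma isCardinalFilteredGenerator_arrowGenerator [HasColimitsOfSize.{v, v} C]
    {μ : Cardinal.{v}} [Fact μ.IsRegular] {P : ObjectProperty C} [ObjectProperty.Small.{v} P]
    (hP : P.IsStrongGenerator) (hP' : P ≤ isCardinalPresentable C μ) :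
    ((arrowGenerator P).colimitsCardinalClosure μ).IsCardinalFilteredGenerator μ := by
  have : (Arrow.leftFunc (C := C)).IsCardinalAccessible μ := ⟨fun _ ↦ inferInstance⟩
  have : (Arrow.rightFunc (C := C)).IsCardinalAccessible μ := ⟨fun _ ↦ inferInstance⟩
  have hQ : arrowGenerator P ≤ isCardinalPresentable (Arrow C) μ := by
    rintro _ (⟨X, hX⟩ | ⟨X, hX⟩)
    all_goals have : IsCardinalPresentable X μ := hP' X hX
    · exact (idArrowAdjunction C).isCardinalPresentable_leftAdjoint_obj μ X
    · exact (initialArrowAdjunction C).isCardinalPresentable_leftAdjoint_obj μ X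
  have := (isStrongGenerator_arrowGenerator hP).isDense_colimitsCardinalClosure_ι hQ
  exact IsCardinalFilteredGenerator.of_isDense_ι.{v, v, max u v} _ _
    (ObjectProperty.colimitsCardinalClosure_le_isCardinalPresentable _ hQ)

lemma colimitsCardinalClosure_arrowGenerator_le [HasColimitsOfSize.{v, v} C]
    {μ : Cardinal.{v}} [Fact μ.IsRegular] {P : ObjectProperty C}
    (hP : P ≤ isCardinalPresentable C μ) :
    (arrowGenerator P).colimitsCardinalClosure μ ≤ presentableEnds C μ := by
  have hc (J : Type v) [SmallCategory J] (hJ : HasCardinalLT (Arrow J) μ) :=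
    isClosedUnderColimitsOfShape_isCardinalPresentable.{v, v, v, v} C hJ
  refine le_inf
    (ObjectProperty.colimitsCardinalClosure_le.{v, v, max u v} _ _ (fun J _ hJ ↦ ?_) ?_)
    (ObjectProperty.colimitsCardinalClosure_le.{v, v, max u v} _ _ (fun J _ hJ ↦ ?_) ?_)
  · have := hc J hJ
    infer_instance
  · rintro _ (⟨X, hX⟩ | ⟨X, hX⟩)
    · exact hP X hX
    · have := isClosedUnderColimitsOfShape_isCardinalPresentable (κ := μ) C
        (J := Discrete PEmpty.{1}) (HasCardinalLT.of_le (by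
          rw [hasCardinalLT_aleph0_iff]; infer_instance) (Cardinal.IsRegular.aleph0_le Fact.out))
      exact ObjectProperty.prop_colimit (isCardinalPresentable C μ) (Functor.empty C)
        (fun j ↦ j.as.elim)
  · have := hc J hJ
    infer_instance
  · rintro _ (⟨X, hX⟩ | ⟨X, hX⟩)
    exacts [hP X hX, hP X hX]

section Pushout

variable {J : Type v} [SmallCategory J] {A B : C} {f : A ⟶ B}
  (p : ColimitPresentation J (Arrow.mk f))

lemma presentation_w_left {i j : J} (φ : i ⟶ j) :
    (p.diag.map φ).left ≫ (p.ι.app j).left = (p.ι.app i).left :=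
  congr_arg (·.left) (p.w φ)

lemma presentation_w_right {i j : J} (φ : i ⟶ j) :
    (p.diag.map φ).right ≫ (p.ι.app j).right = (p.ι.app i).right :=
  congr_arg (·.right) (p.w φ)

lemma presentation_w (j : J) :
    (p.diag.obj j).hom ≫ (p.ι.app j).right = (p.ι.app j).left ≫ f :=
  (Arrow.w (p.ι.app j)).symm

variable [HasPushouts C]

/-- The pushout of `B_j` along `A_j ⟶ A`, for an arrow `A_j ⟶ B_j` in a presentation of an
arrow with source `A`. -/
noncomputable def pushoutObj (j : J) : C :=
  pushout (p.diag.obj j).hom (p.ι.app j).left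

/-- The coprojection `B_j ⟶ B_j ⊔_{A_j} A`. -/
noncomputable def pushoutInl (j : J) : (p.diag.obj j).right ⟶ pushoutObj p j :=
  pushout.inl _ _

/-- The coprojection `A ⟶ B_j ⊔_{A_j} A`. -/
noncomputable def pushoutInr (j : J) : A ⟶ pushoutObj p j :=
  pushout.inr (p.diag.obj j).hom (p.ι.app j).left

lemma pushoutObj_condition (j : J) :
    (p.diag.obj j).hom ≫ pushoutInl p j = (p.ι.app j).left ≫ pushoutInr p j :=
  pushout.condition

variable {p} in
lemma pushoutObj_hom_ext {j : J} {X : C} {a b : pushoutObj p j ⟶ X}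
    (hl : pushoutInl p j ≫ a = pushoutInl p j ≫ b)
    (hr : pushoutInr p j ≫ a = pushoutInr p j ≫ b) : a = b :=
  pushout.hom_ext hl hr

variable {p} in
/-- The morphism out of `B_j ⊔_{A_j} A` induced by compatible morphisms out of `B_j` and `A`. -/
noncomputable def pushoutDesc {j : J} {X : C} (a : (p.diag.obj j).right ⟶ X) (b : A ⟶ X)
    (w : (p.diag.obj j).hom ≫ a = (p.ι.app j).left ≫ b) : pushoutObj p j ⟶ X :=
  pushout.desc a b w

section

variable {p} {j : J} {X Y : C} (a : (p.diag.obj j).right ⟶ X) (b : A ⟶ X)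
  (w : (p.diag.obj j).hom ≫ a = (p.ι.app j).left ≫ b)

@[simp]
lemma pushoutInl_desc : pushoutInl p j ≫ pushoutDesc a b w = a :=
  pushout.inl_desc _ _ _

@[simp]
lemma pushoutInr_desc : pushoutInr p j ≫ pushoutDesc a b w = b :=
  pushout.inr_desc _ _ _

@[simp]
lemma pushoutInl_desc_assoc (g : X ⟶ Y) :
    pushoutInl p j ≫ pushoutDesc a b w ≫ g = a ≫ g := by
  rw [← Category.assoc, pushoutInl_desc]

@[simp]
lemma pushoutInr_desc_assoc (g : X ⟶ Y) :
    pushoutInr p j ≫ pushoutDesc a b w ≫ g = b ≫ g := by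
  rw [← Category.assoc, pushoutInr_desc]

end

/-- The functoriality of `B_j ⊔_{A_j} A` in `j`. -/
noncomputable def pushoutMap {i j : J} (φ : i ⟶ j) : pushoutObj p i ⟶ pushoutObj p j :=
  pushoutDesc ((p.diag.map φ).right ≫ pushoutInl p j) (pushoutInr p j) (by
    rw [← Arrow.w_assoc, pushoutObj_condition, ← Category.assoc]
    exact congr_arg (· ≫ pushoutInr p j) (presentation_w_left p φ))

/-- The pushouts along `A_j ⟶ A` of the arrows `A_j ⟶ B_j` in a presentation of an
arrow with source `A`. -/
noncomputable def pushoutDiagram : J ⥤ Arrow C where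
  obj j := Arrow.mk (pushoutInr p j)
  map {i j} φ := Arrow.homMk (𝟙 A) (pushoutMap p φ)
    ((Category.id_comp _).trans (pushoutInr_desc _ _ _).symm)
  map_id j := by
    ext
    · rfl
    · change pushoutMap p (𝟙 j) = 𝟙 (pushoutObj p j)
      apply pushoutObj_hom_ext <;> simp [pushoutMap]
  map_comp φ ψ := by
    ext
    · exact (Category.id_comp _).symm
    · change pushoutMap p (φ ≫ ψ) = pushoutMap p φ ≫ pushoutMap p ψ
      apply pushoutObj_hom_ext <;> simp [pushoutMap]

/-- The comparison from a diagram of arrows to the diagram of its pushouts. -/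
noncomputable def toPushoutDiagram : p.diag ⟶ pushoutDiagram p where
  app j := Arrow.homMk (p.ι.app j).left (pushoutInl p j) (pushoutObj_condition p j).symm
  naturality i j φ := by
    ext
    · exact (presentation_w_left p φ).trans (Category.comp_id _).symm
    · exact (pushoutInl_desc _ _ _).symm

/-- The cocone with point `f` on the diagram of pushouts. -/
noncomputable def pushoutCocone : Cocone (pushoutDiagram p) where
  pt := Arrow.mk f
  ι :=
    { app j := Arrow.homMk (𝟙 A) (pushoutDesc (p.ι.app j).right f (presentation_w p j))
        ((Category.id_comp _).trans (pushoutInr_desc _ _ _).symm)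
      naturality i j φ := by
        ext
        · rfl
        · change pushoutMap p φ ≫ pushoutDesc _ _ (presentation_w p j) =
            pushoutDesc _ _ (presentation_w p i) ≫ 𝟙 _
          apply pushoutObj_hom_ext
          · simpa [pushoutMap] using presentation_w_right p φ
          · simp [pushoutMap] }

lemma toPushoutDiagram_comp_pushoutCocone (j : J) :
    (toPushoutDiagram p).app j ≫ (pushoutCocone p).ι.app j = p.ι.app j := by
  ext
  · exact Category.comp_id _
  · exact pushoutInl_desc _ _ _

lemma pushoutDiagram_left_eq [IsFiltered J] (s : Cocone (pushoutDiagram p)) (i j : J) :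
    (s.ι.app i).left = ((s.ι.app j).left : A ⟶ s.pt.left) := by
  have h {i j : J} (φ : i ⟶ j) : (s.ι.app i).left = ((s.ι.app j).left : A ⟶ s.pt.left) :=
    (congr_arg (·.left) (s.w φ)).symm.trans (Category.id_comp _)
  exact (h (IsFiltered.leftToMax i j)).trans (h (IsFiltered.rightToMax i j)).symm

/-- The pushouts along `A_j ⟶ A` of the arrows `A_j ⟶ B_j` in a filtered presentation of
`f : A ⟶ B` have colimit `f`. -/
noncomputable def isColimitPushoutCocone [IsFiltered J] [HasColimitsOfShape J C] :
    IsColimit (pushoutCocone p) := by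
  let d (s : Cocone (pushoutDiagram p)) : Arrow.mk f ⟶ s.pt :=
    p.isColimit.desc ((Cocone.precompose (toPushoutDiagram p)).obj s)
  have hd (s : Cocone (pushoutDiagram p)) (j : J) :
      p.ι.app j ≫ d s = (toPushoutDiagram p).app j ≫ s.ι.app j :=
    p.isColimit.fac ((Cocone.precompose (toPushoutDiagram p)).obj s) j
  have hdl (s : Cocone (pushoutDiagram p)) (j : J) : (d s).left = (s.ι.app j).left := by
    refine (isColimitOfPreserves Arrow.leftFunc p.isColimit).hom_ext fun i ↦ ?_
    have := congr_arg (·.left) (hd s i)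
    rw [← pushoutDiagram_left_eq p s i j]
    exact this
  refine { desc := d, fac s j := ?_, uniq s m hm := ?_ }
  · ext
    · exact (Category.id_comp _).trans (hdl s j)
    · refine pushoutObj_hom_ext (p := p) (j := j) ?_ ?_
      · exact (pushoutInl_desc_assoc _ _ (presentation_w p j) _).trans
          (congr_arg (·.right) (hd s j))
      · have h : (d s).left ≫ s.pt.hom = f ≫ (d s).right := Arrow.w (d s)
        rw [hdl s j] at h
        exact (pushoutInr_desc_assoc _ _ (presentation_w p j) _).trans
          (h.symm.trans (Arrow.w (s.ι.app j)))
  · refine p.isColimit.hom_ext fun j ↦ ?_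
    have := hd s j
    rw [← hm j, ← Category.assoc, toPushoutDiagram_comp_pushoutCocone] at this
    exact this.symm

end Pushout

theorem pure_is_filtered_colimit_of_split (κ : Cardinal.{v}) (hκ : κ.IsRegular)
    (hC : IsLocallyPresentable C κ) :
    ∃ π : Cardinal.{v}, π.IsRegular ∧ κ ≤ π ∧
      ∀ μ : Cardinal.{v}, μ.IsRegular → π ≤ μ →
        ∀ ⦃A B : C⦄ (f : A ⟶ B), IsPure μ f →
          ∃ (J : Type v) (_ : SmallCategory J) (F : J ⥤ Arrow C),
            IsCardinalFiltered J μ ∧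
            (∀ j : J, ∃ r : (F.obj j).right ⟶ (F.obj j).left,
                (F.obj j).hom ≫ r = 𝟙 (F.obj j).left) ∧
            ∃ c : Cocone F, Nonempty (IsColimit c) ∧ Nonempty (c.pt ≅ Arrow.mk f) := by
  refine ⟨κ, hκ, le_rfl, fun μ hμ hκμ A B f hf ↦ ?_⟩
  have : Fact κ.IsRegular := ⟨hκ⟩
  have : Fact μ.IsRegular := ⟨hμ⟩
  have : HasColimitsOfSize.{v, v} C := hC.1
  obtain ⟨P, _, hP, hPκ⟩ := hC.exists_isStrongGenerator
  have hPμ := hPκ.trans (isCardinalPresentable_monotone C hκμ)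
  obtain ⟨J, _, _, ⟨p⟩⟩ :=
    (isCardinalFilteredGenerator_arrowGenerator hP hPμ).exists_colimitsOfShape (Arrow.mk f)
  have := isFiltered_of_isCardinalFiltered J μ
  refine ⟨J, inferInstance, pushoutDiagram p.toColimitPresentation,
    (isCardinalFiltered_iff J μ).2 inferInstance, fun j ↦ ?_,
    pushoutCocone _, ⟨isColimitPushoutCocone _⟩, ⟨Iso.refl _⟩⟩
  obtain ⟨hl, hr⟩ := colimitsCardinalClosure_arrowGenerator_le hPμ _ (p.prop_diag_obj j)
  obtain ⟨r, hr⟩ := hf (p.diag.obj j).hom (p.ι.app j).left (p.ι.app j).right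
    ((isPresentableObj_iff μ _).2 hl) ((isPresentableObj_iff μ _).2 hr)
    (presentation_w p.toColimitPresentation j).symm
  exact ⟨pushoutDesc r (𝟙 A) (hr.trans (Category.comp_id _).symm), pushoutInr_desc _ _ _⟩

end Reflection
end

section
/- Let E be a small category, let C = Fun(E, Set) be the category of Set-valued functors on E, let κ be a regular cardinal, and let D ⊆ C be a full subcategory, closed under isomorphisms, which is closed under small limits and under κ-filtered colimits in C. Then there exists a regular cardinal μ ≥ κ such that D is closed under μ-pure morphisms: for every object B of D and every μ-pure morphism f : A → B in C, the object A lies in D. -/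
/-!
STATEMENT 3: Let E be a small category, C = Fun(E, Set), κ a regular cardinal, and
D ⊆ C a full subcategory closed under isomorphisms, small limits and κ-filtered
colimits in C. Then there is a regular cardinal μ ≥ κ such that D is closed under
μ-pure morphisms: if B ∈ D and f : A → B is μ-pure, then A ∈ D.
-/

universe v

open CategoryTheory CategoryTheory.Limits Opposite

namespace Reflection

variable {C : Type u} [Category.{v} C]

def ClosedUnderIso (D : Set C) : Prop :=
  ∀ ⦃X Y : C⦄, (X ≅ Y) → X ∈ D → Y ∈ D

def ClosedUnderLimits (D : Set C) : Prop :=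
  ∀ (J : Type v) [SmallCategory J] (F : J ⥤ C) (c : Cone F),
    IsLimit c → (∀ j, F.obj j ∈ D) → c.pt ∈ D

def ClosedUnderFilteredColimits (D : Set C) (κ : Cardinal.{v}) : Prop :=
  ∀ (J : Type v) [SmallCategory J], IsCardinalFiltered J κ →
    ∀ (F : J ⥤ C) (c : Cocone F), IsColimit c → (∀ j, F.obj j ∈ D) → c.pt ∈ D

section Basics

variable {κ : Cardinal.{v}}

/-- The κ-filteredness used here implies the one of Mathlib. -/
lemma IsCardinalFiltered.toMathlib [Fact κ.IsRegular] {J : Type v} [SmallCategory J]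
    (h : IsCardinalFiltered J κ) : CategoryTheory.IsCardinalFiltered J κ where
  nonempty_cocone {A _} F hA := by
    refine h A ?_ F
    rw [← hasCardinalLT_iff_cardinal_mk_lt]
    exact (hasCardinalLT_iff_of_equiv (Arrow.equivSigma A) κ).1 hA

/-- The κ-filteredness of Mathlib implies the one used here. -/
lemma IsCardinalFiltered.ofMathlib [Fact κ.IsRegular] {J : Type v} [SmallCategory J]
    [CategoryTheory.IsCardinalFiltered J κ] : IsCardinalFiltered J κ := by
  intro A _ hA F
  rw [← hasCardinalLT_iff_cardinal_mk_lt] at hA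
  exact CategoryTheory.IsCardinalFiltered.nonempty_cocone F
    ((hasCardinalLT_iff_of_equiv (Arrow.equivSigma A) κ).2 hA)

/-- A subcategory closed under small limits is closed under equalizers. -/
lemma ClosedUnderLimits.mem_of_isLimit_fork {D : Set C} (hD : ClosedUnderLimits D)
    {X Y : C} {a b : X ⟶ Y} {c : Fork a b} (hc : IsLimit c) (hX : X ∈ D) (hY : Y ∈ D) :
    c.pt ∈ D := by
  let e : WalkingParallelPair ≌ ULiftHom.{v} (ULift.{v} WalkingParallelPair) :=
    ULiftHomULiftCategory.equiv WalkingParallelPair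
  refine hD _ _ _ (hc.whiskerEquivalence e.symm) fun j ↦ ?_
  have (k : WalkingParallelPair) : (parallelPair a b).obj k ∈ D := by
    cases k
    · exact hX
    · exact hY
  exact this _

end Basics

variable {E : Type v} [SmallCategory E]

section Power

/-- The power of a set-valued functor by a type, given by pointwise functions. -/
def power (B : E ⥤ Type v) (X : Type v) : E ⥤ Type v where
  obj e := X → B.obj e
  map φ := ↾fun x i ↦ B.map φ (x i)

/-- Restriction of powers along a map of exponents. -/
def power.restrict (B : E ⥤ Type v) {X Y : Type v} (g : Y → X) : power B X ⟶ power B Y where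
  app e := ↾fun x i ↦ x (g i)

/-- The diagonal map to a power. -/
def power.diag (B : E ⥤ Type v) (X : Type v) : B ⟶ power B X where
  app e := ↾fun x _ ↦ x

/-- Evaluation of a power at an element of the exponent. -/
def power.eval (B : E ⥤ Type v) {X : Type v} (i : X) : power B X ⟶ B where
  app e := ↾fun x ↦ x i

/-- The power of a functor is a product. -/
def power.isLimit (B : E ⥤ Type v) (X : Type v) :
    IsLimit (Fan.mk (power B X) fun i : X ↦ power.eval B i) :=
  Fan.IsLimit.mk _
    (fun s ↦
      { app e := ↾fun y i ↦ (s.proj i).app e y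
        naturality e e' φ := by
          ext y
          funext i
          exact ConcreteCategory.congr_hom ((s.proj i).naturality φ) y })
    (fun s i ↦ rfl)
    (fun s m hm ↦ by
      ext e y
      funext i
      exact ConcreteCategory.congr_hom (congr_app (hm i) e) y)

lemma ClosedUnderLimits.power_mem {D : Set (E ⥤ Type v)} (hD : ClosedUnderLimits D)
    {B : E ⥤ Type v} (hB : B ∈ D) (X : Type v) : power B X ∈ D :=
  hD _ _ _ (power.isLimit B X) fun _ ↦ hB

/-- The diagram of powers of `B` by the final segments of a preorder. -/
def tailPower (B : E ⥤ Type v) (P : Type v) [Preorder P] : P ⥤ E ⥤ Type v where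
  obj p := power B (Set.Ici p)
  map {p q} h := power.restrict B fun i : Set.Ici q ↦ ⟨i.1, (leOfHom h).trans i.2⟩

variable {κ : Cardinal.{v}} {D : Set (E ⥤ Type v)}

/-- If `f : A ⟶ B` is a monomorphism whose image consists of the elements eventually fixed by
a family `h` of self-maps of `B` which is eventually natural, then `A` is an equalizer of maps
from `B` to a reduced power of `B`. -/
lemma mem_of_eventually_fixed [Fact κ.IsRegular] (hlim : ClosedUnderLimits D)
    (hcolim : ClosedUnderFilteredColimits D κ) {P : Type v} [Preorder P]
    [CategoryTheory.IsCardinalFiltered P κ] {A B : E ⥤ Type v} (f : A ⟶ B) (hB : B ∈ D)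
    (hf : ∀ e, Function.Injective (f.app e)) (h : P → ∀ e, B.obj e → B.obj e)
    (hnat : ∀ ⦃e e' : E⦄ (φ : e ⟶ e') (b : B.obj e),
      ∃ p, ∀ q, p ≤ q → h q e' (B.map φ b) = B.map φ (h q e b))
    (hfix : ∀ e (a : A.obj e), ∃ p, ∀ q, p ≤ q → h q e (f.app e a) = f.app e a)
    (himg : ∀ e (b : B.obj e), ∃ p, ∀ q, p ≤ q → h q e b ∈ Set.range (f.app e)) : A ∈ D := by
  have := isFiltered_of_isCardinalFiltered P κ
  let T := colimit (tailPower B P)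
  let c (p : P) : power B (Set.Ici p) ⟶ T := colimit.ι (tailPower B P) p
  have hT : T ∈ D := hcolim P IsCardinalFiltered.ofMathlib _ _
    (colimit.isColimit (tailPower B P)) fun p ↦ hlim.power_mem hB _
  have hc (p : P) (e : E) (x y : (power B (Set.Ici p)).obj e) :
      (c p).app e x = (c p).app e y ↔ ∃ q, p ≤ q ∧ ∀ r (hr : r ∈ Set.Ici p), q ≤ r →
        x ⟨r, hr⟩ = y ⟨r, hr⟩ := by
    refine (Types.FilteredColimit.isColimit_eq_iff' (isColimitOfPreserves
      ((evaluation E (Type v)).obj e) (colimit.isColimit (tailPower B P))) x y).trans ⟨?_, ?_⟩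
    · rintro ⟨q, g, hg⟩
      exact ⟨q, leOfHom g, fun r hr hqr ↦ congr_fun hg ⟨r, hqr⟩⟩
    · rintro ⟨q, hpq, hq⟩
      exact ⟨q, homOfLE hpq, funext fun r ↦ hq r.1 (hpq.trans r.2) r.2⟩
  obtain ⟨p₀⟩ : Nonempty P := IsFiltered.nonempty
  have hev {Q : P → Prop} (hQ : ∃ p, ∀ q, p ≤ q → Q q) :
      ∃ q, p₀ ≤ q ∧ ∀ r ∈ Set.Ici p₀, q ≤ r → Q r := by
    obtain ⟨p, hp⟩ := hQ
    exact ⟨IsFiltered.max p₀ p, leOfHom (IsFiltered.leftToMax p₀ p), fun r _ hr ↦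
      hp r ((leOfHom (IsFiltered.rightToMax p₀ p)).trans hr)⟩
  let t (e : E) (b : B.obj e) : (power B (Set.Ici p₀)).obj e := fun q ↦ h q.1 e b
  let φ : B ⟶ T := power.diag B _ ≫ c p₀
  let ψ : B ⟶ T :=
    { app e := ↾fun b ↦ (c p₀).app e (t e b)
      naturality e e' g := by
        ext b
        refine Eq.trans ?_ (ConcreteCategory.congr_hom ((c p₀).naturality g) (t e b))
        exact (hc _ _ _ _).2 (hev (hnat g b)) }
  have w : f ≫ φ = f ≫ ψ := by
    ext e a
    refine ((hc _ _ _ _).2 ?_).symm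
    exact hev (hfix e a)
  have key {X : E ⥤ Type v} (s : X ⟶ B) (hs : s ≫ φ = s ≫ ψ) (e : E) (x : X.obj e) :
      ∃ a, f.app e a = s.app e x := by
    obtain ⟨q, hq, H⟩ := (hc _ _ _ _).1 (ConcreteCategory.congr_hom (congr_app hs e) x)
    obtain ⟨q', _, H'⟩ := hev (himg e (s.app e x))
    have hr : q ≤ IsFiltered.max q q' := leOfHom (IsFiltered.leftToMax q q')
    obtain ⟨a, ha⟩ := H' _ (hq.trans hr) (leOfHom (IsFiltered.rightToMax q q'))
    exact ⟨a, ha.trans (H _ (hq.trans hr) hr).symm⟩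
  refine hlim.mem_of_isLimit_fork (c := Fork.ofι f w) (Fork.IsLimit.mk' _ fun s ↦ ?_) hB hT
  choose l hl using key s.ι s.condition
  refine ⟨{ app e := ↾(l e), naturality e e' g := ?_ }, ?_, fun {m} hm ↦ ?_⟩
  · ext x
    apply hf
    refine (hl _ _).trans ((ConcreteCategory.congr_hom (s.ι.naturality g) x).trans ?_)
    refine Eq.trans ?_ (ConcreteCategory.congr_hom (f.naturality g) (l e x)).symm
    exact congr_arg (B.map g) (hl e x).symm
  · ext e x
    exact hl e x
  · ext e x
    apply hf
    exact (ConcreteCategory.congr_hom (congr_app hm e) x).trans (hl e x).symm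

end Power

section Presentable

variable {μ : Cardinal.{v}} [Fact μ.IsRegular]

/-- A set-valued functor with fewer than `μ` elements on a category with fewer than `μ` arrows
is `μ`-presentable. -/
lemma isPresentableObj_of_hasCardinalLT (hE : HasCardinalLT (Arrow E) μ) {F : E ⥤ Type v}
    (hF : HasCardinalLT (Σ e, F.obj e) μ) : IsPresentableObj μ F := by
  intro J _ hJ G c hc
  have := hJ.toMathlib
  have := isFiltered_of_isCardinalFiltered J μ
  have hce (e : E) := isColimitOfPreserves ((evaluation E (Type v)).obj e) hc
  have heq {j : J} (e : E) (x y : (G.obj j).obj e)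
      (h : (c.ι.app j).app e x = (c.ι.app j).app e y) :
      ∃ (k : J) (g : j ⟶ k), (G.map g).app e x = (G.map g).app e y :=
    (Types.FilteredColimit.isColimit_eq_iff' (hce e) x y).1 h
  refine ⟨Types.FilteredColimit.isColimitOf' _ _ (fun f ↦ ?_) (fun j f g h ↦ ?_)⟩
  · change F ⟶ c.pt at f
    choose j x hx using fun z : Σ e, F.obj e ↦
      Types.jointly_surjective_of_isColimit (hce z.1) (f.app z.1 z.2)
    let j₀ := IsCardinalFiltered.max j hF
    let y (e : E) (z : F.obj e) : (G.obj j₀).obj e :=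
      (G.map (IsCardinalFiltered.toMax j hF ⟨e, z⟩)).app e (x ⟨e, z⟩)
    have hy (e : E) (z : F.obj e) : (c.ι.app j₀).app e (y e z) = f.app e z :=
      (ConcreteCategory.congr_hom (congr_app (c.w (IsCardinalFiltered.toMax j hF ⟨e, z⟩)) e)
        (x ⟨e, z⟩)).trans (hx ⟨e, z⟩)
    let K := Σ a : Arrow E, F.obj a.left
    have hK : HasCardinalLT K μ := hasCardinalLT_sigma _ _ hE fun a ↦
      hF.of_injective (fun z ↦ (⟨a.left, z⟩ : Σ e, F.obj e)) sigma_mk_injective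
    have hk (i : K) : ∃ (k : J) (g : j₀ ⟶ k),
        (G.map g).app _ (y _ (F.map i.1.hom i.2)) =
          (G.map g).app _ ((G.obj j₀).map i.1.hom (y _ i.2)) := by
      apply heq
      rw [hy]
      refine (ConcreteCategory.congr_hom (f.naturality i.1.hom) i.2).trans ?_
      refine Eq.trans ?_ (ConcreteCategory.congr_hom ((c.ι.app j₀).naturality i.1.hom) (y _ i.2)).symm
      exact congr_arg (c.pt.map i.1.hom) (hy _ i.2).symm
    choose k g hg using hk
    obtain ⟨m, a, b, hab⟩ := IsCardinalFiltered.wideSpan g hK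
    refine ⟨m, { app e := ↾fun z ↦ (G.map b).app e (y e z), naturality e e' φ := ?_ }, ?_⟩
    · ext z
      have := hg ⟨Arrow.mk φ, z⟩
      have hb := hab ⟨Arrow.mk φ, z⟩
      refine Eq.trans ?_ (ConcreteCategory.congr_hom ((G.map b).naturality φ) (y e z))
      change (G.map b).app e' (y e' (F.map φ z)) =
        (G.map b).app e' ((G.obj j₀).map φ (y e z))
      rw [← hb, G.map_comp]
      exact congr_arg ((G.map (a ⟨Arrow.mk φ, z⟩)).app e') this
    · change f = _
      ext e z
      exact (hy e z).symm.trans (ConcreteCategory.congr_hom (congr_app (c.w b) e) (y e z)).symm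
  · change F ⟶ G.obj j at f g
    choose k a ha using fun z : Σ e, F.obj e ↦
      heq z.1 (f.app z.1 z.2) (g.app z.1 z.2) (ConcreteCategory.congr_hom (congr_app h z.1) z.2)
    obtain ⟨m, b, l, hl⟩ := IsCardinalFiltered.wideSpan a hF
    refine ⟨m, l, ?_⟩
    change f ≫ G.map l = g ≫ G.map l
    ext e z
    rw [← hl ⟨e, z⟩, G.map_comp]
    exact congr_arg ((G.map (b ⟨e, z⟩)).app e) (ha ⟨e, z⟩)

end Presentable

section Pure

variable {A B : E ⥤ Type v} (f : A ⟶ B) (μ : Cardinal.{v})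

/-- Pairs of subfunctors with fewer than `μ` elements of the source and of the target of `f`
which are compatible with `f`. -/
structure SmallPair where
  /-- the subfunctor of the source -/
  source : Subfunctor A
  /-- the subfunctor of the target -/
  target : Subfunctor B
  hasCardinalLT_source : HasCardinalLT (Σ e, source.obj e) μ
  hasCardinalLT_target : HasCardinalLT (Σ e, target.obj e) μ
  map_mem : ∀ e, ∀ a ∈ source.obj e, f.app e a ∈ target.obj e

namespace SmallPair

instance : Preorder (SmallPair f μ) :=
  Preorder.lift fun p ↦ (p.source, p.target)

variable {f μ}

/-- The restriction of `f` to a compatible pair of subfunctors. -/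
def hom (p : SmallPair f μ) : p.source.toFunctor ⟶ p.target.toFunctor where
  app e := ↾fun a ↦ ⟨f.app e a.1, p.map_mem e a.1 a.2⟩
  naturality e e' φ := by
    ext a
    refine Subtype.ext ?_
    exact ConcreteCategory.congr_hom (f.naturality φ) a.1

/-- The subfunctor generated by an element. -/
def generated {F : E ⥤ Type v} {e : E} (x : F.obj e) : Subfunctor F where
  obj e' := Set.range fun φ : e ⟶ e' ↦ F.map φ x
  map {e' e''} φ := by
    rintro _ ⟨ψ, rfl⟩
    exact ⟨ψ ≫ φ, by simp⟩

lemma mem_generated {F : E ⥤ Type v} {e : E} (x : F.obj e) : x ∈ (generated x).obj e :=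
  ⟨𝟙 e, by simp⟩

lemma hasCardinalLT_generated (hE : HasCardinalLT (Arrow E) μ) {F : E ⥤ Type v} {e : E}
    (x : F.obj e) : HasCardinalLT (Σ e', (generated x).obj e') μ := by
  have : HasCardinalLT (Σ e', e ⟶ e') μ :=
    hE.of_injective (fun φ ↦ Arrow.mk φ.2) (by
      rintro ⟨e', φ⟩ ⟨e'', ψ⟩ h
      obtain rfl : e' = e'' := congr_arg Comma.right h
      exact congr_arg _ (Arrow.mk_injective _ _ h))
  refine this.of_surjective (fun φ ↦ ⟨φ.1, F.map φ.2 x, φ.2, rfl⟩) ?_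
  rintro ⟨e', _, φ, rfl⟩
  exact ⟨⟨e', φ⟩, rfl⟩

lemma exists_mem_source (hE : HasCardinalLT (Arrow E) μ) {e : E} (a : A.obj e) :
    ∃ p : SmallPair f μ, a ∈ p.source.obj e := by
  refine ⟨⟨generated a, generated (f.app e a), hasCardinalLT_generated hE a,
    hasCardinalLT_generated hE _, ?_⟩, mem_generated a⟩
  rintro e' _ ⟨φ, rfl⟩
  exact ⟨φ, (ConcreteCategory.congr_hom (f.naturality φ) a).symm⟩

variable [Fact μ.IsRegular]

lemma hasCardinalLT_iSup {F : E ⥤ Type v} {K : Type v} (hK : HasCardinalLT K μ)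
    (S : K → Subfunctor F) (hS : ∀ k, HasCardinalLT (Σ e, (S k).obj e) μ) :
    HasCardinalLT (Σ e, (⨆ k, S k).obj e) μ := by
  refine (hasCardinalLT_sigma (fun k ↦ Σ e, (S k).obj e) μ hK hS).of_surjective
    (fun x ↦ ⟨x.2.1, x.2.2.1, by
      rw [Subfunctor.iSup_obj]
      exact Set.mem_iUnion_of_mem x.1 x.2.2.2⟩) ?_
  rintro ⟨e, y, hy⟩
  rw [Subfunctor.iSup_obj] at hy
  obtain ⟨k, hk⟩ := Set.mem_iUnion.1 hy
  exact ⟨⟨k, e, y, hk⟩, rfl⟩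

instance : CategoryTheory.IsCardinalFiltered (SmallPair f μ) μ :=
  isCardinalFiltered_preorder _ _ fun K s hK ↦ by
    rw [← hasCardinalLT_iff_cardinal_mk_lt] at hK
    refine ⟨⟨⨆ k, (s k).source, ⨆ k, (s k).target,
      hasCardinalLT_iSup hK _ fun k ↦ (s k).hasCardinalLT_source,
      hasCardinalLT_iSup hK _ fun k ↦ (s k).hasCardinalLT_target, fun e a ha ↦ ?_⟩,
      fun k ↦ ⟨le_iSup (fun k ↦ (s k).source) k, le_iSup (fun k ↦ (s k).target) k⟩⟩
    rw [Subfunctor.iSup_obj] at ha ⊢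
    obtain ⟨k, hk⟩ := Set.mem_iUnion.1 ha
    exact Set.mem_iUnion_of_mem k ((s k).map_mem e a hk)

lemma exists_mem_target (hE : HasCardinalLT (Arrow E) μ) {e : E} (b : B.obj e) :
    ∃ p : SmallPair f μ, b ∈ p.target.obj e := by
  refine ⟨⟨⊥, generated b, ?_, hasCardinalLT_generated hE b, fun e a ha ↦ ha.elim⟩,
    mem_generated b⟩
  have : IsEmpty (Σ e, (⊥ : Subfunctor A).obj e) := ⟨fun x ↦ x.2.2⟩
  exact hasCardinalLT_of_finite _ _ (Cardinal.IsRegular.aleph0_le Fact.out)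

end SmallPair

variable {f μ}

/-- On every small pair of subfunctors, a pure morphism has a partial retraction. -/
lemma IsPure.exists_retraction [Fact μ.IsRegular] (hE : HasCardinalLT (Arrow E) μ)
    (hf : IsPure μ f) (p : SmallPair f μ) :
    ∃ r : p.target.toFunctor ⟶ A, p.hom ≫ r = p.source.ι :=
  hf p.hom p.source.ι p.target.ι
    (isPresentableObj_of_hasCardinalLT hE p.hasCardinalLT_source)
    (isPresentableObj_of_hasCardinalLT hE p.hasCardinalLT_target) rfl

/-- A subcategory closed under limits and `κ`-filtered colimits is closed under `μ`-pure morphisms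
if `κ ≤ μ` and the index category has fewer than `μ` arrows. -/
lemma IsPure.mem_of_closed {κ : Cardinal.{v}} [Fact κ.IsRegular] [Fact μ.IsRegular] (hκ : κ ≤ μ)
    (hE : HasCardinalLT (Arrow E) μ) (hf : IsPure μ f) {D : Set (E ⥤ Type v)}
    (hlim : ClosedUnderLimits D) (hcolim : ClosedUnderFilteredColimits D κ) (hB : B ∈ D) :
    A ∈ D := by
  classical
  have := IsCardinalFiltered.of_le (SmallPair f μ) hκ
  have := isFiltered_of_isCardinalFiltered (SmallPair f μ) κ
  choose r hr using hf.exists_retraction hE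
  have hr' (p : SmallPair f μ) (e : E) (a : A.obj e) (ha : a ∈ p.source.obj e) :
      (r p).app e ⟨f.app e a, p.map_mem e a ha⟩ = a :=
    ConcreteCategory.congr_hom (congr_app (hr p) e) ⟨a, ha⟩
  let h (p : SmallPair f μ) (e : E) (b : B.obj e) : B.obj e :=
    if hb : b ∈ p.target.obj e then f.app e ((r p).app e ⟨b, hb⟩) else b
  have hh (p : SmallPair f μ) (e : E) (b : B.obj e) (hb : b ∈ p.target.obj e) :
      h p e b = f.app e ((r p).app e ⟨b, hb⟩) := dif_pos hb
  refine mem_of_eventually_fixed hlim hcolim f hB (fun e a a' haa' ↦ ?_) h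
    (fun e e' φ b ↦ ?_) (fun e a ↦ ?_) (fun e b ↦ ?_)
  · obtain ⟨p, hp⟩ := SmallPair.exists_mem_source (f := f) hE a
    obtain ⟨p', hp'⟩ := SmallPair.exists_mem_source (f := f) hE a'
    let q := IsFiltered.max p p'
    have hq := hr' q e a ((leOfHom (IsFiltered.leftToMax p p')).1 e hp)
    have hq' := hr' q e a' ((leOfHom (IsFiltered.rightToMax p p')).1 e hp')
    rw [← hq, ← hq']
    simp only [haa']
  · obtain ⟨p, hp⟩ := SmallPair.exists_mem_target (f := f) hE b
    refine ⟨p, fun q hpq ↦ ?_⟩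
    have hb := hpq.2 e hp
    rw [hh q e b hb, hh q e' _ (q.target.map φ hb)]
    refine (congr_arg (f.app e') (ConcreteCategory.congr_hom ((r q).naturality φ) ⟨b, hb⟩)).trans ?_
    exact ConcreteCategory.congr_hom (f.naturality φ) _
  · obtain ⟨p, hp⟩ := SmallPair.exists_mem_source (f := f) hE a
    refine ⟨p, fun q hpq ↦ ?_⟩
    have ha := hpq.1 e hp
    rw [hh q e _ (q.map_mem e a ha), hr' q e a ha]
  · obtain ⟨p, hp⟩ := SmallPair.exists_mem_target (f := f) hE b
    refine ⟨p, fun q hpq ↦ ?_⟩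
    rw [hh q e b (hpq.2 e hp)]
    exact Set.mem_range_self _

end Pure

theorem closed_under_pure_morphisms
    (E : Type v) [SmallCategory E] (κ : Cardinal.{v}) (hκ : κ.IsRegular)
    (D : Set (E ⥤ Type v)) (hiso : ClosedUnderIso D) (hlim : ClosedUnderLimits D)
    (hcolim : ClosedUnderFilteredColimits D κ) :
    ∃ μ : Cardinal.{v}, μ.IsRegular ∧ κ ≤ μ ∧
      ∀ ⦃A B : E ⥤ Type v⦄ (f : A ⟶ B), B ∈ D → IsPure μ f → A ∈ D := by
  have : Fact κ.IsRegular := ⟨hκ⟩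
  obtain ⟨μ, hμ, h⟩ := HasCardinalLT.exists_regular_cardinal.{v} (Arrow E ⊕ κ.ord.ToType)
  have : Fact μ.IsRegular := ⟨hμ⟩
  rw [hasCardinalLT_sum_iff _ _ _ hμ.aleph0_le] at h
  have hκμ : κ ≤ μ := by
    have := h.2
    rw [hasCardinalLT_iff_cardinal_mk_lt] at this
    simpa using this.le
  exact ⟨μ, hμ, hκμ, fun A B f hB hf ↦ hf.mem_of_closed hκμ h.1 hlim hcolim hB⟩

end Reflection
end

section
/- Let μ be a regular cardinal and let I be a μ-filtered poset. Let P be the poset whose elements are sequences (f₀, f₁, f₂, …) where each f_m is an arbitrary function from I^m (the set of m-tuples of elements of I, with I^0 a one-element set) to I, ordered by (f₀, f₁, …) ≤ (f₀', f₁', …) iff f_m(i₀, …, i_{m−1}) ≤ f_m'(i₀, …, i_{m−1}) for all m and all tuples. Let J ⊆ P be the subset of sequences satisfying f_m(i₀, …, i_{k−1}, i_{k+1}, …, i_m) ≤ f_{m+1}(i₀, …, i_m) for all m ≥ 0, all 0 ≤ k ≤ m, and all i₀, …, i_m ∈ I. Then: (a) every element of P admits an upper bound lying in J (so J is cofinal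 in P); and (b) J, with the induced order, is a μ-filtered poset. -/
/-!
STATEMENT 7: Let μ be a regular cardinal and I a μ-filtered poset. Let P be the poset
of sequences (f₀, f₁, …) with f_m : I^m → I, ordered pointwise, and J ⊆ P the subset
of sequences satisfying f_m(i₀,…,î_k,…,i_m) ≤ f_{m+1}(i₀,…,i_m) for all m, k, tuples.
Then (a) every element of P has an upper bound in J, and (b) J with the induced order
is a μ-filtered poset.
-/

universe u

namespace Reflection

/-- A poset is `μ`-filtered if every subset of cardinality `< μ` has an upper bound. -/
def IsFilteredPoset (I : Type u) [PartialOrder I] (μ : Cardinal.{u}) : Prop :=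
  ∀ S : Set I, Cardinal.mk S < μ → ∃ ub : I, ∀ x ∈ S, x ≤ ub

/-- The poset of sequences `(f₀, f₁, …)` where `f_m : I^m → I`, with the pointwise
order. -/
def SeqPoset (I : Type u) : Type u := (m : ℕ) → (Fin m → I) → I

noncomputable instance (I : Type u) [PartialOrder I] : PartialOrder (SeqPoset I) :=
  inferInstanceAs (PartialOrder ((m : ℕ) → (Fin m → I) → I))

/-- The subset `J` of those sequences such that deleting any coordinate from an
`(m+1)`-tuple only decreases the value. -/
def Jset (I : Type u) [PartialOrder I] : Set (SeqPoset I) :=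
  {f | ∀ (m : ℕ) (k : Fin (m + 1)) (i : Fin (m + 1) → I),
    f m (i ∘ k.succAbove) ≤ f (m + 1) i}

theorem IsFilteredPoset.exists_ge_range {I : Type u} [PartialOrder I] {μ : Cardinal.{u}}
    (hI : IsFilteredPoset I μ) {ι : Type u} (hι : Cardinal.mk ι < μ) (x : ι → I) :
    ∃ ub, ∀ j, x j ≤ ub := by
  obtain ⟨ub, h⟩ := hI (Set.range x) (Cardinal.mk_range_le.trans_lt hι)
  exact ⟨ub, fun j => h _ ⟨j, rfl⟩⟩

theorem IsFilteredPoset.exists_ge_and_ge_of_finite {I : Type u} [PartialOrder I]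
    {μ : Cardinal.{u}} (hμ : Cardinal.aleph0 ≤ μ) (hI : IsFilteredPoset I μ)
    {ι : Type*} [Finite ι] (a : I) (x : ι → I) :
    ∃ ub, a ≤ ub ∧ ∀ j, x j ≤ ub := by
  have hfin : (insert a (Set.range x)).Finite := (Set.finite_range x).insert a
  obtain ⟨ub, h⟩ := hI _ (hfin.lt_aleph0.trans_le hμ)
  exact ⟨ub, h _ (Set.mem_insert _ _), fun j => h _ (Set.mem_insert_of_mem _ ⟨j, rfl⟩)⟩

theorem exists_mem_Jset_ge {I : Type u} [PartialOrder I] {μ : Cardinal.{u}}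
    (hμ : Cardinal.aleph0 ≤ μ) (hI : IsFilteredPoset I μ) (f : SeqPoset I) :
    ∃ g ∈ Jset I, f ≤ g := by
  choose ub hub hub' using fun (m : ℕ) (a : I) (x : Fin (m + 1) → I) =>
    hI.exists_ge_and_ge_of_finite hμ a x
  let g : SeqPoset I := fun m =>
    Nat.rec (motive := fun m => (Fin m → I) → I) (f 0)
      (fun m gm i => ub m (f (m + 1) i) fun k => gm (i ∘ k.succAbove)) m
  refine ⟨g, fun m k i => hub' m (f (m + 1) i) (fun k => g m (i ∘ k.succAbove)) k, ?_⟩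
  rintro (_ | m) i
  · exact le_rfl
  · exact hub m (f (m + 1) i) _

theorem Jset_cofinal_and_filtered (I : Type u) [PartialOrder I]
    (μ : Cardinal.{u}) (hμ : μ.IsRegular) (hI : IsFilteredPoset I μ) :
    (∀ f : SeqPoset I, ∃ g ∈ Jset I, f ≤ g) ∧
      (∀ S : Set (Jset I), Cardinal.mk S < μ →
        ∃ ub : Jset I, ∀ x ∈ S, x ≤ ub) := by
  refine ⟨exists_mem_Jset_ge hμ.aleph0_le hI, fun S hS => ?_⟩
  choose F hF using fun (m : ℕ) (i : Fin m → I) =>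
    hI.exists_ge_range hS fun x : S => x.1.1 m i
  obtain ⟨g, hg, hFg⟩ := exists_mem_Jset_ge hμ.aleph0_le hI F
  exact ⟨⟨g, hg⟩, fun x hx m i => (hF m i ⟨x, hx⟩).trans (hFg m i)⟩

end Reflection
end

section
/- Let I be a nonempty directed poset and let (f₀, f₁, f₂, …) be a sequence of functions, where f_m is a function from I^m (the set of m-tuples of elements of I, with I^0 a one-element set) to I, satisfying f_m(i₀, …, i_{k−1}, i_{k+1}, …, i_m) ≤ f_{m+1}(i₀, …, i_m) for all m ≥ 0, all 0 ≤ k ≤ m, and all i₀, …, i_m ∈ I. Define a category M whose objects are pairs (n, (i₀, …, iₙ)) with n a natural number and i_k ≥ f_k(i₀, …, i_{k−1}) for all 0 ≤ k ≤ n, and whose morphisms (k, (i₀, …, i_k)) → (n, (i₀', …, iₙ')) are the strictly monotone maps h : {0, …, k} → {0, …, n} such that i_m = i'_{h(m)} for all 0 ≤ m ≤ k, with composition given by composition of such maps. Then the geometric realization of the nerve of M is a contractible topological space (i.e., M is weakly contractible). -/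
/-!
STATEMENT 9: Let I be a nonempty directed poset and (f₀, f₁, …) a sequence of
functions f_m : I^m → I with f_m(i₀,…,î_k,…,i_m) ≤ f_{m+1}(i₀,…,i_m). Let M be the
category whose objects are pairs (n, (i₀,…,iₙ)) with i_k ≥ f_k(i₀,…,i_{k−1}) and whose
morphisms are strictly monotone reindexing maps compatible with the tuples. Then the
geometric realization of the nerve of M is contractible.
-/

open CategoryTheory

namespace Reflection

/-- Objects of the category `M`: pairs of `n : ℕ` and a tuple `(i₀, …, iₙ)` such that
`i_k ≥ f_k(i₀, …, i_{k−1})` for all `k`. -/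
structure MObj (I : Type) [PartialOrder I] (f : (m : ℕ) → (Fin m → I) → I) : Type where
  n : ℕ
  seq : Fin (n + 1) → I
  cond : ∀ k : Fin (n + 1),
    f k (fun j : Fin (k : ℕ) => seq ⟨(j : ℕ), j.2.trans k.2⟩) ≤ seq k

instance (I : Type) [PartialOrder I] (f : (m : ℕ) → (Fin m → I) → I) :
    Category (MObj I f) where
  Hom a b := {h : Fin (a.n + 1) → Fin (b.n + 1) //
    StrictMono h ∧ ∀ m : Fin (a.n + 1), a.seq m = b.seq (h m)}
  id a := ⟨id, strictMono_id, fun _ => rfl⟩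
  comp u v := ⟨v.1 ∘ u.1, v.2.1.comp u.2.1,
    fun m => (u.2.2 m).trans (v.2.2 (u.1 m))⟩
  id_comp := by intros; rfl
  comp_id := by intros; rfl
  assoc := by intros; rfl

section Realization

open Simplicial Opposite

/-- The characteristic map of a simplex. -/
noncomputable def charMap (X : SSet.{0}) {m : ℕ} (a : X.obj (op ⦋m⦌)) :
    C(stdSimplex ℝ (Fin (m + 1)), SSet.toTop.obj X) :=
  TopCat.toSSetObjEquiv _ _ ((sSetTopAdj.unit.app X).app _ a)

lemma charMap_map (X : SSet.{0}) {m l : ℕ} (a : X.obj (op ⦋m⦌)) (f : ⦋l⦌ ⟶ ⦋m⦌)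
    (t : stdSimplex ℝ (Fin (l + 1))) :
    charMap X (X.map f.op a) t = charMap X a (stdSimplex.map f t) := by
  unfold charMap
  have := NatTrans.naturality_apply (sSetTopAdj.unit.app X) f.op a
  exact congrArg (fun b => TopCat.toSSetObjEquiv _ _ b t) this

lemma homEquiv_apply (X : SSet.{0}) (Z : TopCat.{0}) (u : SSet.toTop.obj X ⟶ Z) {m : ℕ}
    (a : X.obj (op ⦋m⦌)) (t : stdSimplex ℝ (Fin (m + 1))) :
    TopCat.toSSetObjEquiv _ _ ((sSetTopAdj.homEquiv X Z u).app _ a) t = u (charMap X a t) := by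
  rw [Adjunction.homEquiv_unit]
  rfl

lemma exists_realization_map (X : SSet.{0}) (Z : TopCat.{0}) (φ : X ⟶ TopCat.toSSet.obj Z) :
    ∃ u : C(SSet.toTop.obj X, Z), ∀ (m : ℕ) (a : X.obj (op ⦋m⦌)) (t : stdSimplex ℝ (Fin (m + 1))),
      u (charMap X a t) = TopCat.toSSetObjEquiv _ _ (φ.app _ a) t := by
  refine ⟨((sSetTopAdj.homEquiv X Z).symm φ).hom, fun m a t => ?_⟩
  have := homEquiv_apply X Z ((sSetTopAdj.homEquiv X Z).symm φ) a t
  rw [Equiv.apply_symm_apply] at this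
  exact this.symm

lemma realization_ext (X : SSet.{0}) (Z : Type) [TopologicalSpace Z]
    (u v : C(SSet.toTop.obj X, Z))
    (h : ∀ (m : ℕ) (a : X.obj (op ⦋m⦌)) (t : stdSimplex ℝ (Fin (m + 1))),
      u (charMap X a t) = v (charMap X a t)) : u = v := by
  have : TopCat.ofHom (Y := TopCat.of Z) u = TopCat.ofHom (Y := TopCat.of Z) v := by
    apply (sSetTopAdj.homEquiv X (TopCat.of Z)).injective
    ext ⟨⟨m⟩⟩ a
    apply (TopCat.toSSetObjEquiv _ _).injective
    ext t
    exact (homEquiv_apply X _ _ a t).trans ((h m a t).trans (homEquiv_apply X _ _ a t).symm)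
  exact congrArg TopCat.Hom.hom this

end Realization

section Weights

lemma stdSimplex_map_apply {X Y : Type} [Fintype X] [Fintype Y] [DecidableEq Y] (f : X → Y)
    (s : stdSimplex ℝ X) (y : Y) : stdSimplex.map f s y = ∑ x with f x = y, s x := by
  simp [FunOnFinite.linearMap_apply_apply]

lemma stdSimplex_map_apply_injective {X Y : Type} [Fintype X] [Fintype Y] (f : X → Y)
    (hf : Function.Injective f) (s : stdSimplex ℝ X) (x : X) :
    stdSimplex.map f s (f x) = s x := by
  classical
  rw [stdSimplex_map_apply, Finset.sum_eq_single x] <;> simp +contextual [hf.eq_iff]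

lemma stdSimplex_map_ne_zero {X Y : Type} [Fintype X] [Fintype Y] (f : X → Y)
    (s : stdSimplex ℝ X) (y : Y) : stdSimplex.map f s y ≠ 0 ↔ ∃ x, f x = y ∧ s x ≠ 0 := by
  classical
  rw [stdSimplex_map_apply, Ne, Finset.sum_eq_zero_iff_of_nonneg (by simp)]
  simp

lemma stdSimplex_eq_map_of_injective {X Y : Type} [Fintype X] [Fintype Y] (f : X → Y)
    (hf : Function.Injective f) (s : stdSimplex ℝ X) (t : stdSimplex ℝ Y)
    (h : ∀ x, t (f x) = s x) (h0 : ∀ y, t y ≠ 0 → ∃ x, f x = y) : stdSimplex.map f s = t := by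
  ext y
  by_cases hy : ∃ x, f x = y
  · obtain ⟨x, rfl⟩ := hy
    rw [stdSimplex_map_apply_injective f hf, h]
  · have h1 : stdSimplex.map f s y = 0 := by
      by_contra h'
      obtain ⟨x, hx, -⟩ := (stdSimplex_map_ne_zero f s y).1 h'
      exact hy ⟨x, hx⟩
    have h2 : t y = 0 := by
      by_contra h'
      exact hy (h0 y h')
    rw [h1, h2]

lemma stdSimplex_sum_comp {X Y : Type} [Fintype X] [Fintype Y] (f : X → Y)
    (hf : Function.Injective f) (t : stdSimplex ℝ Y)
    (h0 : ∀ y, t y ≠ 0 → ∃ x, f x = y) : ∑ x, t (f x) = 1 := by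
  rw [← stdSimplex.sum_eq_one t]
  exact Fintype.sum_of_injective f hf _ _ (fun y hy => by_contra fun h => hy (h0 y h))
    fun _ => rfl

/-- The restriction of a weight function along an injection whose range contains the support. -/
def restrictWeight {X Y : Type} [Fintype X] [Fintype Y] (f : X → Y)
    (hf : Function.Injective f) (t : stdSimplex ℝ Y)
    (h0 : ∀ y, t y ≠ 0 → ∃ x, f x = y) : stdSimplex ℝ X :=
  ⟨fun x => t (f x), fun _ => stdSimplex.zero_le _ _, stdSimplex_sum_comp f hf t h0⟩

lemma map_restrictWeight {X Y : Type} [Fintype X] [Fintype Y] (f : X → Y)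
    (hf : Function.Injective f) (t : stdSimplex ℝ Y)
    (h0 : ∀ y, t y ≠ 0 → ∃ x, f x = y) : stdSimplex.map f (restrictWeight f hf t h0) = t :=
  stdSimplex_eq_map_of_injective f hf _ t (fun _ => rfl) h0

lemma stdSimplex_map_injective {X Y : Type} [Fintype X] [Fintype Y] (f : X → Y)
    (hf : Function.Injective f) :
    Function.Injective (stdSimplex.map f : stdSimplex ℝ X → stdSimplex ℝ Y) := by
  intro s t h
  ext x
  rw [← stdSimplex_map_apply_injective f hf s, h, stdSimplex_map_apply_injective f hf t]

/-- The points of the order complex of a finite poset: weight functions supported on a chain. -/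
abbrev ChainWeight (P : Type) [PartialOrder P] [Fintype P] : Type :=
  {w : stdSimplex ℝ P // IsChain (· ≤ ·) {p | w p ≠ 0}}

variable {P P' : Type} [PartialOrder P] [Fintype P] [PartialOrder P'] [Fintype P']

/-- Pushforward of a weight function on a chain along a monotone map. -/
noncomputable def ChainWeight.push (f : P → P') (hf : Monotone f) (w : ChainWeight P) :
    ChainWeight P' :=
  ⟨stdSimplex.map f w.1, by
    intro p hp q hq _
    obtain ⟨p, rfl, hp'⟩ := (stdSimplex_map_ne_zero _ _ _).1 hp
    obtain ⟨q, rfl, hq'⟩ := (stdSimplex_map_ne_zero _ _ _).1 hq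
    exact (w.2.total hp' hq').imp (fun h => hf h) (fun h => hf h)⟩

/-- The weight function on a poset induced by a point of a simplex. -/
noncomputable def ChainWeight.ofSimplex {m : ℕ} (a : Fin (m + 1) → P) (ha : Monotone a)
    (t : stdSimplex ℝ (Fin (m + 1))) : ChainWeight P :=
  ⟨stdSimplex.map a t, by
    intro p hp q hq _
    obtain ⟨p, rfl, hp⟩ := (stdSimplex_map_ne_zero _ _ _).1 hp
    obtain ⟨q, rfl, hq⟩ := (stdSimplex_map_ne_zero _ _ _).1 hq
    exact (le_total p q).imp (fun h => ha h) (fun h => ha h)⟩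

omit [Fintype P] in
lemma exists_enum_of_isChain (c : Finset P) (hc : IsChain (· ≤ ·) (c : Set P)) (h0 : c.Nonempty) :
    ∃ (k : ℕ) (ι : Fin (k + 1) → P), StrictMono ι ∧ ∀ p, p ∈ c ↔ ∃ i, ι i = p := by
  classical
  let L : LinearOrder c :=
    { (inferInstance : PartialOrder c) with
      le_total := fun a b => hc.total a.2 b.2
      toDecidableLE := Classical.decRel _ }
  obtain ⟨k, hk⟩ : ∃ k, c.card = k + 1 := ⟨c.card - 1, (Nat.sub_add_cancel h0.card_pos).symm⟩
  let e := Fintype.orderIsoFinOfCardEq c (h := by rw [Fintype.card_coe, hk])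
  refine ⟨k, fun i => (e i : P), fun i j h => ?_, fun p => ⟨fun hp => ⟨e.symm ⟨p, hp⟩, ?_⟩, ?_⟩⟩
  · exact Subtype.coe_lt_coe.2 (e.strictMono h)
  · simp
  · rintro ⟨i, rfl⟩
    exact (e i).2

lemma ChainWeight.exists_enum (w : ChainWeight P) :
    ∃ (k : ℕ) (ι : Fin (k + 1) → P), StrictMono ι ∧ ∀ p, w.1 p ≠ 0 ↔ ∃ i, ι i = p := by
  classical
  obtain ⟨k, ι, h, h'⟩ := exists_enum_of_isChain (Finset.univ.filter fun p => w.1 p ≠ 0)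
    (by simpa using w.2) (by
      by_contra hne
      rw [Finset.not_nonempty_iff_eq_empty] at hne
      have := stdSimplex.sum_eq_one w.1
      rw [Finset.sum_eq_zero] at this
      · simp at this
      · intro p _
        by_contra hp
        exact Finset.notMem_empty p (hne ▸ by simpa using hp))
  exact ⟨k, ι, h, fun p => by simpa using h' p⟩

end Weights

section Realize

open Simplicial Opposite

variable {P : Type} [PartialOrder P] {C : Type} [Category.{0} C]

/-- The simplex of the nerve of `C` given by a monotone sequence in `P` and a functor `P ⥤ C`. -/
def simplexOf (F : P ⥤ C) {m : ℕ} (a : Fin (m + 1) → P) (ha : Monotone a) :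
    (nerve C).obj (op ⦋m⦌) := ha.functor ⋙ F

lemma charMap_simplexOf_comp (F : P ⥤ C) {m l : ℕ} (a : Fin (m + 1) → P) (ha : Monotone a)
    (θ : Fin (l + 1) → Fin (m + 1)) (hθ : Monotone θ) (t : stdSimplex ℝ (Fin (l + 1))) :
    charMap _ (simplexOf F (a ∘ θ) (ha.comp hθ)) t =
      charMap _ (simplexOf F a ha) (stdSimplex.map θ t) :=
  charMap_map (nerve C) (simplexOf F a ha) (SimplexCategory.Hom.mk ⟨θ, hθ⟩) t

variable [Fintype P]

lemma charMap_simplexOf_eq (F : P ⥤ C) {m k : ℕ} (a : Fin (m + 1) → P) (ha : Monotone a)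
    (ι : Fin (k + 1) → P) (hι : StrictMono ι) (t : stdSimplex ℝ (Fin (m + 1)))
    (s : stdSimplex ℝ (Fin (k + 1))) (h : stdSimplex.map a t = stdSimplex.map ι s) :
    charMap _ (simplexOf F a ha) t = charMap _ (simplexOf F ι hι.monotone) s := by
  obtain ⟨l, j, hj, hj'⟩ := ChainWeight.exists_enum (P := Fin (m + 1))
    ⟨t, fun _ _ _ _ _ => le_total _ _⟩
  obtain ⟨t, rfl⟩ : ∃ t', stdSimplex.map j t' = t :=
    ⟨_, map_restrictWeight j hj.injective t fun i => (hj' i).1⟩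
  rw [← charMap_simplexOf_comp F a ha j hj.monotone]
  rw [stdSimplex.map_comp_apply] at h
  have hne : ∀ i, stdSimplex.map j t (j i) ≠ 0 := fun i => (hj' (j i)).2 ⟨i, rfl⟩
  have h1 : ∀ i, ∃ i', ι i' = a (j i) := fun i => by
    have : stdSimplex.map ι s (a (j i)) ≠ 0 := by
      rw [← h, stdSimplex_map_ne_zero]
      refine ⟨i, rfl, ?_⟩
      rw [← stdSimplex_map_apply_injective j hj.injective]
      exact hne i
    obtain ⟨i', hi, -⟩ := (stdSimplex_map_ne_zero _ _ _).1 this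
    exact ⟨i', hi⟩
  choose θ hθ using h1
  have hθ' : Monotone θ := fun i i' hi => by
    rw [← hι.le_iff_le, hθ, hθ]
    exact ha (hj.monotone hi)
  obtain rfl : s = stdSimplex.map θ t := by
    apply stdSimplex_map_injective ι hι.injective
    rw [← h, stdSimplex.map_comp_apply]
    congr 1
    exact funext fun i => (hθ i).symm
  rw [← charMap_simplexOf_comp F ι hι.monotone θ hθ']
  have key : ι ∘ θ = a ∘ j := funext hθ
  congr 2
  simp only [key]

/-- The point of the realization of the nerve of `C` determined by a functor `P ⥤ C`
and a weight function on a chain of `P`. -/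
noncomputable def realizeFun (F : P ⥤ C) (w : ChainWeight P) : SSet.toTop.obj (nerve C) :=
  charMap _ (simplexOf F w.exists_enum.choose_spec.choose
      w.exists_enum.choose_spec.choose_spec.1.monotone)
    (restrictWeight _ w.exists_enum.choose_spec.choose_spec.1.injective w.1
      fun p => (w.exists_enum.choose_spec.choose_spec.2 p).1)

lemma realizeFun_eq (F : P ⥤ C) (w : ChainWeight P) {m : ℕ} (a : Fin (m + 1) → P)
    (ha : Monotone a) (t : stdSimplex ℝ (Fin (m + 1))) (h : stdSimplex.map a t = w.1) :
    realizeFun F w = charMap _ (simplexOf F a ha) t :=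
  (charMap_simplexOf_eq F a ha _ w.exists_enum.choose_spec.choose_spec.1 t _
    (h.trans (map_restrictWeight _ _ _ _).symm)).symm

lemma continuous_realizeFun (F : P ⥤ C) : Continuous (realizeFun F) := by
  classical
  let S : Finset P → Set (ChainWeight P) := fun c =>
    {w | IsChain (· ≤ ·) (c : Set P) ∧ ∀ p, w.1 p ≠ 0 → p ∈ c}
  have hev : ∀ p : P, Continuous fun w : ChainWeight P => w.1 p := fun p =>
    (continuous_apply p).comp (continuous_subtype_val.comp continuous_subtype_val)
  refine (locallyFinite_of_finite S).continuous ?_ ?_ ?_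
  · refine Set.eq_univ_of_forall fun w => Set.mem_iUnion.2
      ⟨Finset.univ.filter fun p => w.1 p ≠ 0, by simpa using w.2, fun p hp => by simpa using hp⟩
  · intro c
    have : S c = {w | IsChain (· ≤ ·) (c : Set P)} ∩ ⋂ p : P, ⋂ _ : p ∉ c, {w | w.1 p = 0} := by
      ext w
      simp only [S, Set.mem_ofPred_eq, Set.mem_inter_iff, Set.mem_iInter]
      exact and_congr_right fun _ => forall_congr' fun p => not_imp_comm
    rw [this]
    exact isClosed_const.inter (isClosed_iInter fun p => isClosed_iInter fun _ =>
      isClosed_eq (hev p) continuous_const)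
  · intro c
    by_cases hc : IsChain (· ≤ ·) (c : Set P) ∧ c.Nonempty
    · obtain ⟨k, ι, hι, hι'⟩ := exists_enum_of_isChain c hc.1 hc.2
      rw [continuousOn_iff_continuous_domRestrict]
      have h0 : ∀ w : S c, ∀ p, w.1.1 p ≠ 0 → ∃ i, ι i = p := fun w p hp =>
        (hι' p).1 (w.2.2 p hp)
      have : (S c).domRestrict (realizeFun F) = fun w : S c =>
          charMap _ (simplexOf F ι hι.monotone)
            (restrictWeight ι hι.injective w.1.1 (h0 w)) :=
        funext fun w => realizeFun_eq F w.1 ι hι.monotone _ (map_restrictWeight _ _ _ _)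
      rw [this]
      refine (charMap _ _).continuous.comp (Continuous.subtype_mk (continuous_pi fun i => ?_) _)
      exact (hev (ι i)).comp continuous_subtype_val
    · have : S c = ∅ := by
        refine Set.eq_empty_of_forall_notMem fun w hw => hc ⟨hw.1, ?_⟩
        obtain ⟨k, ι, -, -⟩ := w.exists_enum
        by_contra hne
        rw [Finset.not_nonempty_iff_eq_empty] at hne
        subst hne
        have := stdSimplex.sum_eq_one w.1
        rw [Finset.sum_eq_zero fun p _ => by_contra fun h =>
          Finset.notMem_empty p (hw.2 p h)] at this
        simp at this
      rw [this]
      exact continuousOn_empty _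

lemma realizeFun_push {P' : Type} [PartialOrder P'] [Fintype P'] (F : P' ⥤ C) (f : P → P')
    (hf : Monotone f) (w : ChainWeight P) :
    realizeFun F (w.push f hf) = realizeFun (hf.functor ⋙ F) w := by
  obtain ⟨k, ι, hι, h0⟩ := w.exists_enum
  have h1 := map_restrictWeight ι hι.injective w.1 fun p => (h0 p).1
  rw [realizeFun_eq _ w ι hι.monotone _ h1, realizeFun_eq F (w.push f hf) (f ∘ ι)
    (hf.comp hι.monotone) (restrictWeight ι hι.injective w.1 fun p => (h0 p).1)]
  · rfl
  · rw [← stdSimplex.map_comp_apply, h1]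
    rfl

lemma realizeFun_ofSimplex (F : P ⥤ C) {m : ℕ} (a : Fin (m + 1) → P) (ha : Monotone a)
    (t : stdSimplex ℝ (Fin (m + 1))) :
    realizeFun F (.ofSimplex a ha t) = charMap _ (simplexOf F a ha) t :=
  realizeFun_eq F _ a ha t rfl

end Realize

section Barycentric

/-- The poset of nonempty finite chains of a poset. -/
abbrev Chains (P : Type) [PartialOrder P] : Type :=
  {B : Finset P // B.Nonempty ∧ IsChain (· ≤ ·) (B : Set P)}

variable {P P' : Type} [PartialOrder P] [PartialOrder P']

noncomputable instance [Fintype P] : Fintype (Chains P) :=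
  Fintype.ofFinite _

/-- The map on chains induced by an order embedding. -/
def Chains.map (i : P ↪o P') (B : Chains P) : Chains P' :=
  ⟨B.1.map i.toEmbedding, by simpa using B.2.1, by
    intro p hp q hq _
    simp only [Finset.coe_map, Set.mem_image] at hp hq
    obtain ⟨p, hp, rfl⟩ := hp
    obtain ⟨q, hq, rfl⟩ := hq
    simpa using B.2.2.total hp hq⟩

lemma Chains.monotone_map (i : P ↪o P') : Monotone (Chains.map i) :=
  fun _ _ h => Finset.map_subset_map.2 h

lemma Chains.map_injective (i : P ↪o P') : Function.Injective (Chains.map i) :=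
  fun _ _ h => Subtype.ext (Finset.map_injective _ (congrArg Subtype.val h))

variable [Fintype P] [Fintype P']

open Classical in
/-- The amount by which a weight function on `B` exceeds its values outside of `B`. -/
noncomputable def gap (w : P → ℝ) (B : Chains P) : ℝ :=
  max 0 ((B.1 ×ˢ Finset.univ).inf' (B.2.1.product ⟨B.2.1.choose, Finset.mem_univ _⟩)
    fun q => if q.2 ∈ B.1 then w q.1 else w q.1 - w q.2)

lemma gap_nonneg (w : P → ℝ) (B : Chains P) : 0 ≤ gap w B := le_max_left _ _

lemma gap_ne_zero (w : P → ℝ) (B : Chains P) :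
    gap w B ≠ 0 ↔ ∀ a ∈ B.1, ∀ p, 0 < w a ∧ (p ∉ B.1 → w p < w a) := by
  classical
  rw [← (gap_nonneg w B).lt_iff_ne', gap, lt_max_iff, or_iff_right (lt_irrefl _),
    Finset.lt_inf'_iff]
  simp only [Finset.mem_product, Finset.mem_univ, and_true, Prod.forall]
  refine forall_congr' fun a => ⟨fun h ha p => ⟨?_, fun hp => ?_⟩, fun h p ha => ?_⟩
  · simpa [ha] using h a ha
  · simpa [hp] using h p ha
  · split_ifs with hp
    · exact (h ha p).1
    · exact sub_pos.2 ((h ha p).2 hp)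

lemma continuous_gap (B : Chains P) : Continuous fun w : P → ℝ => gap w B := by
  classical
  unfold gap
  refine continuous_const.max (Continuous.finset_inf'_apply _ fun q _ => ?_)
  split_ifs <;> fun_prop

lemma gap_comparable (w : P → ℝ) (B B' : Chains P) (h : gap w B ≠ 0) (h' : gap w B' ≠ 0) :
    B ≤ B' ∨ B' ≤ B := by
  rw [gap_ne_zero] at h h'
  by_contra! hn
  obtain ⟨a, ha, ha'⟩ := Finset.not_subset.1 hn.1
  obtain ⟨b, hb, hb'⟩ := Finset.not_subset.1 hn.2
  exact lt_asymm ((h a ha b).2 hb') ((h' b hb a).2 ha')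

lemma gap_map (w : stdSimplex ℝ P) (i : P ↪o P') (B : Chains P) :
    gap (stdSimplex.map i w) (B.map i) = gap w B := by
  classical
  unfold gap
  congr 1
  apply le_antisymm
  · refine Finset.le_inf' _ _ fun q hq => ?_
    refine (Finset.inf'_le _ (b := (i q.1, i q.2)) ?_).trans ?_
    · simpa [Chains.map] using hq
    · simp only [stdSimplex_map_apply_injective i i.injective]
      simp [Chains.map]
  · refine Finset.le_inf' _ _ fun q hq => ?_
    obtain ⟨q1, q2⟩ := q
    simp only [Chains.map, Finset.mem_product, Finset.mem_map, Finset.mem_univ, and_true] at hq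
    obtain ⟨a, ha, rfl⟩ := hq
    by_cases hr : ∃ p, i p = q2
    · obtain ⟨p, rfl⟩ := hr
      refine (Finset.inf'_le _ (b := (a, p)) (by simpa using ha)).trans ?_
      have h1 := stdSimplex_map_apply_injective i i.injective w
      simp [Chains.map, h1, -stdSimplex.map_coe]
    · refine (Finset.inf'_le _ (b := (a, a)) (by simpa using ha)).trans ?_
      have h1 := stdSimplex_map_apply_injective i i.injective w
      have h2 : stdSimplex.map i w q2 = 0 := by
        by_contra h
        obtain ⟨p, hp, -⟩ := (stdSimplex_map_ne_zero _ _ _).1 h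
        exact hr ⟨p, hp⟩
      simp [h1, h2, ha, -stdSimplex.map_coe]

lemma exists_gap_ne_zero (w : ChainWeight P) : ∃ B, gap w.1 B ≠ 0 := by
  classical
  obtain ⟨k, ι, hι, hk⟩ := w.exists_enum
  have hne : (Finset.univ : Finset P).Nonempty := ⟨ι 0, Finset.mem_univ _⟩
  obtain ⟨a, -, ha⟩ := Finset.exists_max_image Finset.univ (fun p => w.1 p) hne
  have hpos : 0 < w.1 a := lt_of_lt_of_le
    (lt_of_le_of_ne (stdSimplex.zero_le _ _) ((hk (ι 0)).2 ⟨0, rfl⟩).symm) (ha (ι 0) (by simp))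
  refine ⟨⟨Finset.univ.filter fun p => w.1 p = w.1 a, ⟨a, by simp⟩, ?_⟩, ?_⟩
  · refine w.2.mono fun p hp => ?_
    simp only [Finset.coe_filter, Finset.mem_univ, true_and, Set.mem_ofPred_eq] at hp ⊢
    exact hp ▸ hpos.ne'
  · rw [gap_ne_zero]
    intro b hb p
    simp only [Finset.mem_filter, Finset.mem_univ, true_and] at hb ⊢
    rw [hb]
    exact ⟨hpos, fun hp => lt_of_le_of_ne (ha p (by simp)) hp⟩

lemma sum_gap_pos (w : ChainWeight P) : 0 < ∑ B, gap w.1 B := by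
  obtain ⟨B, hB⟩ := exists_gap_ne_zero w
  exact Finset.sum_pos' (fun B _ => gap_nonneg _ B)
    ⟨B, Finset.mem_univ _, lt_of_le_of_ne (gap_nonneg _ B) hB.symm⟩

/-- A point of the order complex of a poset as a point of its barycentric subdivision
(up to reparametrization). -/
noncomputable def barycentric (w : ChainWeight P) : ChainWeight (Chains P) :=
  ⟨⟨fun B => gap w.1 B / ∑ B', gap w.1 B',
    fun B => div_nonneg (gap_nonneg _ _) (sum_gap_pos w).le, by
      rw [← Finset.sum_div, div_self (sum_gap_pos w).ne']⟩, by
    intro B hB B' hB' _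
    exact gap_comparable _ B B' (fun h => hB (div_eq_zero_iff.2 (.inl h)))
      (fun h => hB' (div_eq_zero_iff.2 (.inl h)))⟩

lemma barycentric_apply (w : ChainWeight P) (B : Chains P) :
    (barycentric w).1 B = gap w.1 B / ∑ B', gap w.1 B' := rfl

lemma barycentric_ne_zero {w : ChainWeight P} {B : Chains P} (h : (barycentric w).1 B ≠ 0) :
    ∀ a ∈ B.1, w.1 a ≠ 0 := by
  have : gap w.1 B ≠ 0 := fun h' => h (by rw [barycentric_apply, h', zero_div])
  rw [gap_ne_zero] at this
  exact fun a ha => (this a ha a).1.ne'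

lemma continuous_barycentric : Continuous (barycentric (P := P)) := by
  have h : ∀ B : Chains P, Continuous fun w : ChainWeight P => gap w.1 B := fun B =>
    (continuous_gap B).comp (continuous_subtype_val.comp continuous_subtype_val)
  exact Continuous.subtype_mk (Continuous.subtype_mk (continuous_pi fun B =>
    (h B).div (continuous_finsetSum _ fun B _ => h B) fun w => (sum_gap_pos w).ne') _) _

lemma barycentric_push (i : P ↪o P') (w : ChainWeight P) :
    barycentric (w.push i i.monotone) =
      (barycentric w).push (Chains.map i) (Chains.monotone_map i) := by
  classical
  have h0 : ∀ B : Chains P', gap (stdSimplex.map i w.1) B ≠ 0 → ∃ B', Chains.map i B' = B := by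
    intro B hB
    have hB' : ∀ b ∈ B.1, ∃ p, i p = b := fun b hb => by
      have := ((gap_ne_zero _ _).1 hB b hb b).1
      obtain ⟨p, hp, -⟩ := (stdSimplex_map_ne_zero _ _ _).1 this.ne'
      exact ⟨p, hp⟩
    have hmap : (B.1.preimage i i.injective.injOn).map i.toEmbedding = B.1 := by
      ext b
      simp only [Finset.mem_map, Finset.mem_preimage]
      exact ⟨fun ⟨p, hp, h⟩ => h ▸ hp, fun hb => by
        obtain ⟨p, hp⟩ := hB' b hb
        exact ⟨p, by rw [hp]; exact hb, hp⟩⟩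
    refine ⟨⟨B.1.preimage i i.injective.injOn, ?_, ?_⟩, Subtype.ext hmap⟩
    · rw [← Finset.map_nonempty, hmap]
      exact B.2.1
    · intro p hp q hq _
      simpa using B.2.2.total (Finset.mem_preimage.1 hp) (Finset.mem_preimage.1 hq)
  have hsum : ∑ B, gap (stdSimplex.map i w.1) B = ∑ B, gap w.1 B := by
    symm
    exact Fintype.sum_of_injective _ (Chains.map_injective i) _ _
      (fun B hB => by_contra fun h => hB (h0 B h)) fun B => (gap_map w.1 i B).symm
  apply Subtype.ext
  symm
  refine stdSimplex_eq_map_of_injective _ (Chains.map_injective i) _ _ (fun B => ?_) fun B hB => ?_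
  · change gap (stdSimplex.map i w.1) _ / ∑ B, gap (stdSimplex.map i w.1) B = gap _ _ / _
    rw [hsum, gap_map]
  · refine h0 B fun h => hB ?_
    change gap (stdSimplex.map i w.1) _ / _ = _
    rw [h, zero_div]

end Barycentric

section Labels

/-- Labels: the vertices of a simplex, followed by one apex for each set of vertices. -/
abbrev Label (N : ℕ) : Type := Lex (Fin N ⊕ Colex (Finset (Fin N)))

variable {N N' : ℕ}

/-- The label of a vertex. -/
def vtx (v : Fin N) : Label N := toLex (Sum.inl v)

/-- The label of the apex attached to a set of vertices. -/
def apex (S : Finset (Fin N)) : Label N := toLex (Sum.inr (toColex S))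

@[elab_as_elim]
lemma Label.cases {motive : Label N → Prop} (hv : ∀ v, motive (vtx v))
    (ha : ∀ S, motive (apex S)) (l : Label N) : motive l := by
  rcases l with v | S
  · exact hv v
  · exact ha (ofColex S)

lemma vtx_injective : Function.Injective (vtx (N := N)) := fun _ _ h =>
  Sum.inl_injective (toLex.injective h)

lemma apex_injective : Function.Injective (apex (N := N)) := fun _ _ h =>
  toColex.injective (Sum.inr_injective (toLex.injective h))

@[simp] lemma vtx_ne_apex (v : Fin N) (S : Finset (Fin N)) : vtx v ≠ apex S := fun h =>
  Sum.inl_ne_inr (toLex.injective h)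

@[simp] lemma apex_ne_vtx (v : Fin N) (S : Finset (Fin N)) : apex S ≠ vtx v :=
  (vtx_ne_apex v S).symm

@[simp] lemma vtx_lt_vtx {v v' : Fin N} : vtx v < vtx v' ↔ v < v' := Sum.Lex.inl_lt_inl_iff

@[simp] lemma apex_not_lt_vtx {v : Fin N} {S : Finset (Fin N)} : ¬ apex S < vtx v :=
  Sum.Lex.not_inr_lt_inl

@[simp] lemma vtx_lt_apex (v : Fin N) (S : Finset (Fin N)) : vtx v < apex S :=
  Sum.Lex.inl_lt_inr _ _

@[simp] lemma apex_lt_apex {S S' : Finset (Fin N)} : apex S < apex S' ↔ toColex S < toColex S' :=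
  Sum.Lex.inr_lt_inr_iff

/-- The map on labels induced by an embedding of simplices. -/
def labelMapFun (e : Fin N ↪o Fin N') : Label N → Label N' := fun l =>
  match ofLex l with
  | Sum.inl v => vtx (e v)
  | Sum.inr S => apex ((ofColex S).map e.toEmbedding)

lemma labelMapFun_strictMono (e : Fin N ↪o Fin N') : StrictMono (labelMapFun e) := by
  intro l l'
  refine Label.cases (fun v => ?_) (fun S => ?_) l <;>
    refine Label.cases (fun v' => ?_) (fun S' => ?_) l'
  · intro h
    exact vtx_lt_vtx.2 (e.strictMono (vtx_lt_vtx.1 h))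
  · intro _
    exact vtx_lt_apex _ _
  · intro h
    exact absurd h apex_not_lt_vtx
  · intro h
    refine apex_lt_apex.2 ?_
    have := (Finset.Colex.toColex_image_lt_toColex_image e.strictMono).2 (apex_lt_apex.1 h)
    simp only [← RelEmbedding.coe_toEmbedding, ← Finset.map_eq_image] at this
    exact this

/-- The order embedding on labels induced by an embedding of simplices. -/
def labelMap (e : Fin N ↪o Fin N') : Label N ↪o Label N' :=
  OrderEmbedding.ofStrictMono _ (labelMapFun_strictMono e)

@[simp] lemma labelMap_vtx (e : Fin N ↪o Fin N') (v : Fin N) : labelMap e (vtx v) = vtx (e v) :=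
  rfl

@[simp] lemma labelMap_apex (e : Fin N ↪o Fin N') (S : Finset (Fin N)) :
    labelMap e (apex S) = apex (S.map e.toEmbedding) := rfl

/-- The admissible sets of labels. -/
abbrev LabelSet (N : ℕ) : Type :=
  {A : Finset (Label N) // A.Nonempty ∧ (∀ v S, vtx v ∈ A → apex S ∈ A → v ∈ S) ∧
    ∀ S S', apex S ∈ A → apex S' ∈ A → S ⊆ S' ∨ S' ⊆ S}

noncomputable instance : Fintype (LabelSet N) :=
  haveI : Finite (Colex (Finset (Fin N))) := Finite.of_equiv _ toColex
  haveI : Finite (Label N) := Finite.of_equiv _ toLex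
  Fintype.ofFinite _

/-- The map on admissible sets of labels induced by an embedding of simplices. -/
def LabelSet.map (e : Fin N ↪o Fin N') (A : LabelSet N) : LabelSet N' :=
  ⟨A.1.map (labelMap e).toEmbedding, by simpa using A.2.1, by
    intro v S hv hS
    rw [Finset.mem_map] at hv hS
    obtain ⟨l, hl, hl'⟩ := hv
    obtain ⟨l₂, hl₂, hl₂'⟩ := hS
    revert hl hl' hl₂ hl₂'
    refine Label.cases (fun v => ?_) (fun S => ?_) l <;>
      refine Label.cases (fun v' => ?_) (fun S' => ?_) l₂ <;> intro h1 h2 h3 h4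
    · exact absurd h4 (vtx_ne_apex _ _)
    · obtain rfl := vtx_injective h2
      obtain rfl := apex_injective h4
      exact Finset.mem_map_of_mem _ (A.2.2.1 _ _ h1 h3)
    · exact absurd h4 (vtx_ne_apex _ _)
    · exact absurd h2 (apex_ne_vtx _ _), by
    intro v S hv hS
    rw [Finset.mem_map] at hv hS
    obtain ⟨l, hl, hl'⟩ := hv
    obtain ⟨l₂, hl₂, hl₂'⟩ := hS
    revert hl hl' hl₂ hl₂'
    refine Label.cases (fun v => ?_) (fun S => ?_) l <;>
      refine Label.cases (fun v' => ?_) (fun S' => ?_) l₂ <;> intro h1 h2 h3 h4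
    · exact absurd h4 (vtx_ne_apex _ _)
    · exact absurd h2 (vtx_ne_apex _ _)
    · exact absurd h4 (vtx_ne_apex _ _)
    · obtain rfl := apex_injective h2
      obtain rfl := apex_injective h4
      exact (A.2.2.2 _ _ h1 h3).imp Finset.map_subset_map.2 Finset.map_subset_map.2⟩

lemma LabelSet.monotone_map (e : Fin N ↪o Fin N') : Monotone (LabelSet.map e) :=
  fun _ _ h => Finset.map_subset_map.2 h

end Labels

section Values

variable {I : Type} [PartialOrder I] {f : (m : ℕ) → (Fin m → I) → I}

lemma face_le (hf : ∀ (m : ℕ) (k : Fin (m + 1)) (i : Fin (m + 1) → I),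
      f m (i ∘ k.succAbove) ≤ f (m + 1) i) :
    ∀ {m k : ℕ} (u : Fin k → Fin m) (_ : StrictMono u) (y : Fin m → I), f k (y ∘ u) ≤ f m y := by
  intro m
  induction m with
  | zero =>
    intro k u hu y
    obtain rfl : k = 0 := Nat.le_zero.1 (by simpa using Fintype.card_le_of_injective u hu.injective)
    exact (congrArg (f 0) (Subsingleton.elim _ _)).le
  | succ m ih =>
    intro k u hu y
    by_cases hs : Function.Surjective u
    · obtain rfl : k = m + 1 := by simpa using Fintype.card_of_bijective ⟨hu.injective, hs⟩
      obtain rfl : u = id := funext fun i => congrArg (fun e : Fin (m + 1) ≃o Fin (m + 1) => e i)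
        (Subsingleton.elim (hu.orderIsoOfSurjective u hs) (OrderIso.refl _))
      exact le_rfl
    · obtain ⟨j, hj⟩ := not_forall.1 hs
      choose u' hu' using fun i => Fin.exists_succAbove_eq (x := u i) (y := j) fun h => hj ⟨i, h⟩
      obtain rfl : u = j.succAbove ∘ u' := funext fun i => (hu' i).symm
      have : StrictMono u' := fun a b h => (Fin.strictMono_succAbove j).lt_iff_lt.1 (hu h)
      exact (ih u' this (y ∘ j.succAbove)).trans (hf m j y)

lemma exists_bound (hdir : ∀ S : Finset I, ∃ ub : I, ∀ x ∈ S, x ≤ ub) (E : Finset I) (N : ℕ) :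
    ∃ b : I, ∀ (k : ℕ) (u : Fin k → I), k ≤ N → (∀ j, u j ∈ E) → f k u ≤ b := by
  classical
  obtain ⟨b, hb⟩ := hdir (Finset.univ.image
    fun p : (k : Fin (N + 1)) × (Fin k → E) => f p.1 fun j => p.2 j)
  exact ⟨b, fun k u hk hu => hb _ (Finset.mem_image.2
    ⟨⟨⟨k, Nat.lt_succ_of_le hk⟩, fun j => ⟨u j, hu j⟩⟩, Finset.mem_univ _, rfl⟩)⟩

open Classical in
/-- A finite set containing the entries of `E` and the values of the apexes of all sets of
fewer than `m` vertices. -/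
noncomputable def valuePool (b : Finset I → ℕ → I) : ℕ → Finset I → Finset I
  | 0, E => E
  | m + 1, E => valuePool b m E ∪ E.powerset.image fun E' => b (valuePool b m E') (m + 2 ^ m)

/-- The value of the apex of a set of `m` vertices with entries `E`. -/
noncomputable def apexValue (b : Finset I → ℕ → I) (m : ℕ) (E : Finset I) : I :=
  b (valuePool b m E) (m + 2 ^ m)

omit [PartialOrder I] in
lemma valuePool_mono (b : Finset I → ℕ → I) (E : Finset I) : Monotone fun m => valuePool b m E :=
  monotone_nat_of_le_succ fun m => by
    classical
    exact Finset.subset_union_left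

omit [PartialOrder I] in
lemma apexValue_mem (b : Finset I → ℕ → I) {m m' : ℕ} (hm : m < m') {E E' : Finset I}
    (hE : E ⊆ E') : apexValue b m E ∈ valuePool b m' E' := by
  classical
  refine valuePool_mono b E' hm (Finset.mem_union_right _ (Finset.mem_image_of_mem _ ?_))
  exact Finset.mem_powerset.2 hE

open Classical in
/-- The element of `I` attached to a label. -/
noncomputable def value (b : Finset I → ℕ → I) (x : MObj I f) (l : Label (x.n + 1)) : I :=
  match ofLex l with
  | Sum.inl v => x.seq v
  | Sum.inr S => apexValue b (ofColex S).card ((ofColex S).image x.seq)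

open Classical in
lemma value_apex (b : Finset I → ℕ → I) (x : MObj I f) (S : Finset (Fin (x.n + 1))) :
    value b x (apex S) = apexValue b S.card (S.image x.seq) := rfl

/-- The order embedding underlying a morphism. -/
def homEmb {x y : MObj I f} (g : x ⟶ y) : Fin (x.n + 1) ↪o Fin (y.n + 1) :=
  OrderEmbedding.ofStrictMono g.1 g.2.1

lemma value_labelMap (b : Finset I → ℕ → I) {x y : MObj I f} (g : x ⟶ y)
    (l : Label (x.n + 1)) : value b y (labelMap (homEmb g) l) = value b x l := by
  classical
  refine Label.cases (fun v => ?_) (fun S => ?_) l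
  · exact (g.2.2 v).symm
  · rw [labelMap_apex, value_apex, value_apex, Finset.card_map, Finset.map_eq_image,
      Finset.image_image]
    congr 2
    exact funext fun v => (g.2.2 v).symm

lemma hom_ext {x y : MObj I f} {g g' : x ⟶ y} (h : ∀ m, g.1 m = g'.1 m) : g = g' :=
  Subtype.ext (funext h)

lemma exists_eqToHom {x y : MObj I f} (g : x ⟶ y) (hn : x.n = y.n) :
    ∃ e : x = y, g = eqToHom e := by
  obtain ⟨n, s, c⟩ := x
  obtain ⟨n', s', c'⟩ := y
  dsimp only at hn
  subst hn
  obtain ⟨g, hg, hs⟩ := g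
  have hsurj : Function.Surjective g := Finite.surjective_of_injective hg.injective
  obtain rfl : g = id := funext fun i => congrArg (fun e : Fin (n + 1) ≃o Fin (n + 1) => e i)
    (Subsingleton.elim (hg.orderIsoOfSurjective g hsurj) (OrderIso.refl _))
  obtain rfl : s = s' := funext hs
  exact ⟨rfl, rfl⟩

lemma functor_eq {P : Type} [Category P] {F F' : P ⥤ MObj I f} (η : F ⟶ F')
    (hn : ∀ p, (F.obj p).n = (F'.obj p).n) : F = F' := by
  choose e he using fun p => exists_eqToHom (η.app p) (hn p)
  refine CategoryTheory.Functor.ext e fun p q g => ?_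
  have := η.naturality g
  rw [he, he] at this
  rw [← Category.assoc, ← this]
  simp

/-- A function bounding the values of `f` on short tuples with entries in a finite set. -/
def IsBound (f : (m : ℕ) → (Fin m → I) → I) (b : Finset I → ℕ → I) : Prop :=
  ∀ (E : Finset I) (N k : ℕ) (u : Fin k → I), k ≤ N → (∀ j, u j ∈ E) → f k u ≤ b E N

variable (hf : ∀ (m : ℕ) (k : Fin (m + 1)) (i : Fin (m + 1) → I),
      f m (i ∘ k.succAbove) ≤ f (m + 1) i)
  {b : Finset I → ℕ → I} (hb : IsBound f b)

include hf hb in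
lemma value_cond (x : MObj I f) (A : LabelSet (x.n + 1)) {k : ℕ} (u : Fin k → Label (x.n + 1))
    (hu : StrictMono u) (huA : ∀ j, u j ∈ A.1) (l : Label (x.n + 1)) (hl : l ∈ A.1)
    (hlt : ∀ j, u j < l) : f k (fun j => value b x (u j)) ≤ value b x l := by
  classical
  revert hl hlt
  refine Label.cases (fun v => ?_) (fun S => ?_) l <;> intro hl hlt
  · have : ∀ j, ∃ w : Fin (x.n + 1), vtx w = u j := fun j => by
      have := hlt j
      revert this
      refine Label.cases (fun w => ?_) (fun S => ?_) (u j) <;> intro h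
      · exact ⟨w, rfl⟩
      · exact absurd h apex_not_lt_vtx
    choose w hw using this
    have hwv : ∀ j, w j < v := fun j => vtx_lt_vtx.1 (by rw [hw]; exact hlt j)
    have hmono : StrictMono fun j => (⟨w j, hwv j⟩ : Fin v) := fun i j h => by
      change w i < w j
      exact vtx_lt_vtx.1 (((hw i).trans_lt (hu h)).trans_eq (hw j).symm)
    simp only [← hw]
    exact (face_le hf _ hmono (fun j : Fin v => x.seq ⟨j, j.2.trans v.2⟩)).trans (x.cond v)
  · rw [value_apex, apexValue]
    have key : ∀ j, (∃ v ∈ S, u j = vtx v) ∨ ∃ S', S' ⊂ S ∧ u j = apex S' := fun j => by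
      have h1 := hlt j
      have h2 := huA j
      revert h1 h2
      refine Label.cases (fun w => ?_) (fun S' => ?_) (u j) <;> intro h1 h2
      · exact .inl ⟨w, A.2.2.1 _ _ h2 hl, rfl⟩
      · refine .inr ⟨S', ?_, rfl⟩
        have h3 := apex_lt_apex.1 h1
        rcases A.2.2.2 _ _ h2 hl with h | h
        · exact h.ssubset_of_ne (by rintro rfl; exact lt_irrefl _ h3)
        · exact absurd h3 (Finset.Colex.toColex_le_toColex_of_subset h).not_gt
    refine hb _ _ _ _ ?_ fun j => ?_
    · have hsub : Finset.univ.image u ⊆ S.image vtx ∪ S.powerset.image apex := by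
        intro l hl
        obtain ⟨j, -, rfl⟩ := Finset.mem_image.1 hl
        rcases key j with ⟨v, hv, h⟩ | ⟨S', hS, h⟩ <;> rw [h]
        · exact Finset.mem_union_left _ (Finset.mem_image_of_mem _ hv)
        · exact Finset.mem_union_right _
            (Finset.mem_image_of_mem _ (Finset.mem_powerset.2 hS.subset))
      have := Finset.card_le_card hsub
      rw [Finset.card_image_of_injective _ hu.injective, Finset.card_univ, Fintype.card_fin] at this
      refine this.trans ((Finset.card_union_le _ _).trans (add_le_add Finset.card_image_le ?_))
      exact Finset.card_image_le.trans (Finset.card_powerset _).le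
    · rcases key j with ⟨v, hv, h⟩ | ⟨S', hS, h⟩ <;> rw [h]
      · exact valuePool_mono b _ (Nat.zero_le _) (Finset.mem_image_of_mem _ hv)
      · exact apexValue_mem b (Finset.card_lt_card hS) (Finset.image_subset_image hS.subset)

lemma LabelSet.card_eq {N : ℕ} (A : LabelSet N) : A.1.card = A.1.card - 1 + 1 :=
  (Nat.sub_add_cancel A.2.1.card_pos).symm

/-- The object of `M` given by an admissible set of labels. -/
noncomputable def tupleObj (x : MObj I f) (A : LabelSet (x.n + 1)) : MObj I f where
  n := A.1.card - 1
  seq i := value b x (A.1.orderEmbOfFin A.card_eq i)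
  cond k := value_cond hf hb x A (fun j => A.1.orderEmbOfFin A.card_eq ⟨j, j.2.trans k.2⟩)
    (fun _ _ h => (OrderEmbedding.strictMono _) h) (fun _ => Finset.orderEmbOfFin_mem _ _ _) _
    (Finset.orderEmbOfFin_mem _ _ _) fun j => (OrderEmbedding.strictMono _) j.2

/-- The labels of the entries of the tuple given by an admissible set of labels. -/
noncomputable def tupleEmb (x : MObj I f) (A : LabelSet (x.n + 1)) :
    Fin ((tupleObj hf hb x A).n + 1) ↪o Label (x.n + 1) :=
  A.1.orderEmbOfFin A.card_eq

lemma tupleEmb_mem (x : MObj I f) (A : LabelSet (x.n + 1)) (i) :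
    tupleEmb hf hb x A i ∈ A.1 := Finset.orderEmbOfFin_mem _ _ _

lemma tupleObj_seq (x : MObj I f) (A : LabelSet (x.n + 1)) (i) :
    (tupleObj hf hb x A).seq i = value b x (tupleEmb hf hb x A i) := rfl

/-- A strictly increasing family of labels in an admissible set as a morphism of `M`. -/
noncomputable def toTuple {x y : MObj I f} (A : LabelSet (x.n + 1))
    (φ : Fin (y.n + 1) → Label (x.n + 1)) (hφ : StrictMono φ) (hA : ∀ m, φ m ∈ A.1)
    (hv : ∀ m, y.seq m = value b x (φ m)) : y ⟶ tupleObj hf hb x A :=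
  ⟨fun m => (A.1.orderIsoOfFin A.card_eq).symm ⟨φ m, hA m⟩,
    fun _ _ h => (OrderIso.strictMono _) (Subtype.mk_lt_mk.2 (hφ h)), fun m => by
      rw [hv]
      change _ = value b x (A.1.orderEmbOfFin A.card_eq _)
      rw [← Finset.coe_orderIsoOfFin_apply, OrderIso.apply_symm_apply]⟩

@[simp]
lemma tupleEmb_toTuple {x y : MObj I f} (A : LabelSet (x.n + 1))
    (φ : Fin (y.n + 1) → Label (x.n + 1)) (hφ : StrictMono φ) (hA : ∀ m, φ m ∈ A.1)
    (hv : ∀ m, y.seq m = value b x (φ m)) (m : Fin (y.n + 1)) :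
    tupleEmb hf hb x A ((toTuple hf hb A φ hφ hA hv).1 m) = φ m :=
  (Finset.coe_orderIsoOfFin_apply _ _ _).symm.trans
    (congrArg Subtype.val (OrderIso.apply_symm_apply (A.1.orderIsoOfFin A.card_eq) _))

lemma tupleObj_hom_ext {x y : MObj I f} (A : LabelSet (x.n + 1))
    {g g' : y ⟶ tupleObj hf hb x A}
    (h : ∀ m, tupleEmb hf hb x A (g.1 m) = tupleEmb hf hb x A (g'.1 m)) : g = g' :=
  hom_ext fun m => (tupleEmb hf hb x A).injective (h m)

lemma comp_apply {x y z : MObj I f} (g : x ⟶ y) (g' : y ⟶ z) (m : Fin (x.n + 1)) :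
    (g ≫ g').1 m = g'.1 (g.1 m) := rfl

lemma id_apply (x : MObj I f) (m : Fin (x.n + 1)) : (𝟙 x : x ⟶ x).1 m = m := rfl

/-- The functor sending an admissible set of labels to its tuple of values. -/
noncomputable def tupleFunctor (x : MObj I f) : LabelSet (x.n + 1) ⥤ MObj I f where
  obj A := tupleObj hf hb x A
  map {A B} g := toTuple hf hb B (tupleEmb hf hb x A) (OrderEmbedding.strictMono _)
    (fun _ => leOfHom g (tupleEmb_mem hf hb x A _)) (tupleObj_seq hf hb x A)
  map_id A := tupleObj_hom_ext hf hb A fun m => by rw [tupleEmb_toTuple, id_apply]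
  map_comp {A B C} g g' := tupleObj_hom_ext hf hb C fun m => by
    rw [comp_apply, tupleEmb_toTuple, tupleEmb_toTuple, tupleEmb_toTuple]

lemma tupleEmb_map (x : MObj I f) {A B : LabelSet (x.n + 1)} (g : A ⟶ B)
    (m : Fin ((tupleObj hf hb x A).n + 1)) :
    tupleEmb hf hb x B (((tupleFunctor hf hb x).map g).1 m) = tupleEmb hf hb x A m :=
  tupleEmb_toTuple hf hb B (tupleEmb hf hb x A) (OrderEmbedding.strictMono _)
    (fun _ => leOfHom g (tupleEmb_mem hf hb x A _)) (tupleObj_seq hf hb x A) m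

/-- The component at `A` of the comparison of the tuples of `A` and of its image along `g`. -/
noncomputable def tupleMap {x y : MObj I f} (g : x ⟶ y) (A : LabelSet (x.n + 1)) :
    tupleObj hf hb x A ⟶ tupleObj hf hb y (A.map (homEmb g)) :=
  toTuple hf hb (A.map (homEmb g)) (labelMap (homEmb g) ∘ tupleEmb hf hb x A)
    ((OrderEmbedding.strictMono _).comp (OrderEmbedding.strictMono _))
    (fun _ => Finset.mem_map_of_mem _ (tupleEmb_mem hf hb x A _))
    fun _ => (value_labelMap b g _).symm

lemma tupleEmb_tupleMap {x y : MObj I f} (g : x ⟶ y) (A : LabelSet (x.n + 1))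
    (m : Fin ((tupleObj hf hb x A).n + 1)) :
    tupleEmb hf hb y (A.map (homEmb g)) ((tupleMap hf hb g A).1 m) =
      labelMap (homEmb g) (tupleEmb hf hb x A m) :=
  tupleEmb_toTuple hf hb (A.map (homEmb g)) (labelMap (homEmb g) ∘ tupleEmb hf hb x A) _ _ _ m

lemma tupleFunctor_map {x y : MObj I f} (g : x ⟶ y) :
    (LabelSet.monotone_map (homEmb g)).functor ⋙ tupleFunctor hf hb y =
      tupleFunctor hf hb x :=
  (functor_eq (F := tupleFunctor hf hb x)
    (F' := (LabelSet.monotone_map (homEmb g)).functor ⋙ tupleFunctor hf hb y)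
    { app := tupleMap hf hb g
      naturality := fun A B h => tupleObj_hom_ext hf hb _ fun m =>
        ((tupleEmb_tupleMap hf hb g B _).trans
          (congrArg (labelMap _) (tupleEmb_map hf hb x h m))).trans
        ((tupleEmb_map hf hb y ((LabelSet.monotone_map (homEmb g)).functor.map h) _).trans
          (tupleEmb_tupleMap hf hb g A m)).symm }
    fun _ => congrArg (· - 1) (Finset.card_map _).symm).symm

end Values

section RealizationLift

open Simplicial Opposite

lemma exists_realization_lift (X : SSet.{0}) (Z : Type) [TopologicalSpace Z]
    (φ : ∀ m : ℕ, X.obj (op ⦋m⦌) → C(stdSimplex ℝ (Fin (m + 1)), Z))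
    (hφ : ∀ (m l : ℕ) (a : X.obj (op ⦋m⦌)) (g : ⦋l⦌ ⟶ ⦋m⦌) (t : stdSimplex ℝ (Fin (l + 1))),
      φ l (X.map g.op a) t = φ m a (stdSimplex.map g t)) :
    ∃ u : C(SSet.toTop.obj X, Z), ∀ (m : ℕ) (a : X.obj (op ⦋m⦌)) (t : stdSimplex ℝ (Fin (m + 1))),
      u (charMap X a t) = φ m a t := by
  obtain ⟨u, hu⟩ := exists_realization_map X (TopCat.of Z)
    { app := fun n => ↾fun a => (TopCat.toSSetObjEquiv (TopCat.of Z) n).symm (φ n.unop.len a)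
      naturality := fun n n' g => by
        ext a
        apply (TopCat.toSSetObjEquiv (TopCat.of Z) n').injective
        ext t
        have h1 := TopCat.toSSetObjEquiv_naturality_apply (X := TopCat.of Z) g.unop
          ((TopCat.toSSetObjEquiv (TopCat.of Z) n).symm (φ n.unop.len a)) t
        refine Eq.trans ?_ h1.symm
        refine Eq.trans ?_ ((hφ _ _ a g.unop t).trans ?_)
        · exact DFunLike.congr_fun (Equiv.apply_symm_apply _ _) t
        · exact (DFunLike.congr_fun (Equiv.apply_symm_apply _ _) _).symm }
  refine ⟨u, fun m a t => (hu m a t).trans ?_⟩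
  exact DFunLike.congr_fun
    (Equiv.apply_symm_apply (TopCat.toSSetObjEquiv (TopCat.of Z) (op ⦋m⦌)) (φ m a)) t

end RealizationLift

section Faces

variable {N N' : ℕ}

/-- The poset of nonempty sets of vertices of a simplex. -/
abbrev Face (N : ℕ) : Type := {S : Finset (Fin N) // S.Nonempty}

/-- The map on faces induced by an embedding of simplices. -/
def faceMap (e : Fin N ↪o Fin N') (S : Face N) : Face N' :=
  ⟨S.1.map e.toEmbedding, by simpa using S.2⟩

lemma faceMap_mono (e : Fin N ↪o Fin N') : Monotone (faceMap e) :=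
  fun _ _ h => Finset.map_subset_map.2 h

/-- A nonempty set of vertices as an admissible set of labels. -/
def faceLabels (S : Face N) : LabelSet N :=
  ⟨S.1.map ⟨vtx, vtx_injective⟩, by simpa using S.2, by simp, by simp⟩

lemma faceLabels_mono : Monotone (faceLabels (N := N)) :=
  fun _ _ h => Finset.map_subset_map.2 h

lemma faceLabels_faceMap (e : Fin N ↪o Fin N') (S : Face N) :
    faceLabels (faceMap e S) = (faceLabels S).map e := by
  apply Subtype.ext
  change (S.1.map _).map _ = (S.1.map _).map _
  rw [Finset.map_map, Finset.map_map]
  rfl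

end Faces

section Lift

variable {I : Type} [PartialOrder I] {f : (m : ℕ) → (Fin m → I) → I}

/-- The morphism from an entry of a chain of morphisms to the last one. -/
def lastHom {m : ℕ} (σ : ComposableArrows (MObj I f) m) (i : Fin (m + 1)) :
    σ.obj i ⟶ σ.obj (Fin.last m) := σ.map (homOfLE (Fin.le_last i))

lemma map_lastHom {m : ℕ} (σ : ComposableArrows (MObj I f) m) {i j : Fin (m + 1)} (h : i ⟶ j) :
    σ.map h ≫ lastHom σ j = lastHom σ i := by
  rw [lastHom, ← Functor.map_comp]
  rfl

/-- The image of a morphism. -/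
def homFace {x y : MObj I f} (g : x ⟶ y) : Face (y.n + 1) :=
  ⟨Finset.univ.map (homEmb g).toEmbedding, by simp⟩

lemma faceMap_homFace {x y z : MObj I f} (g : x ⟶ y) (g' : y ⟶ z) :
    faceMap (homEmb g') (homFace g) = homFace (g ≫ g') :=
  Subtype.ext (Finset.map_map _ _ _)

/-- The face of the last entry of a chain of morphisms given by the image of another entry. -/
def imageFace {m : ℕ} (σ : ComposableArrows (MObj I f) m) (i : Fin (m + 1)) :
    Face ((σ.obj (Fin.last m)).n + 1) :=
  homFace (lastHom σ i)

lemma imageFace_mono {m : ℕ} (σ : ComposableArrows (MObj I f) m) : Monotone (imageFace σ) := by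
  intro i j h v hv
  obtain ⟨w, -, rfl⟩ := Finset.mem_map.1 hv
  refine Finset.mem_map.2 ⟨(σ.map (homOfLE h)).1 w, Finset.mem_univ _, ?_⟩
  exact congrArg (fun g => g.1 w) (map_lastHom σ (homOfLE h))

open Simplicial Opposite

lemma exists_lift (Z : Type) [TopologicalSpace Z]
    (Φ : ∀ x : MObj I f, C(ChainWeight (Face (x.n + 1)), Z))
    (hΦ : ∀ (x y : MObj I f) (g : x ⟶ y) (w : ChainWeight (Face (x.n + 1))),
      Φ y (w.push (faceMap (homEmb g)) (faceMap_mono _)) = Φ x w) :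
    ∃ u : C(SSet.toTop.obj (nerve (MObj I f)), Z),
      ∀ (m : ℕ) (σ : ComposableArrows (MObj I f) m) (t : stdSimplex ℝ (Fin (m + 1))),
        u (charMap (nerve (MObj I f)) (m := m) σ t) =
          Φ (σ.obj (Fin.last m)) (.ofSimplex (imageFace σ) (imageFace_mono σ) t) := by
  refine exists_realization_lift (nerve (MObj I f)) Z (fun m (σ : ComposableArrows (MObj I f) m) =>
    ⟨fun t => Φ (σ.obj (Fin.last m)) (.ofSimplex (imageFace σ) (imageFace_mono σ) t), ?_⟩) ?_
  · refine (Φ _).continuous.comp (Continuous.subtype_mk ?_ _)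
    exact stdSimplex.continuous_map _
  · intro m l (σ : ComposableArrows (MObj I f) m) θ t
    let g : σ.obj (θ (Fin.last l)) ⟶ σ.obj (Fin.last m) := lastHom σ (θ (Fin.last l))
    refine (hΦ _ _ g _).symm.trans (congrArg _ (Subtype.ext ?_))
    have key : ∀ a : Fin (l + 1) → Face ((σ.obj (θ (Fin.last l))).n + 1),
        (∀ i, faceMap (homEmb g) (a i) = imageFace σ (θ i)) →
        stdSimplex.map (faceMap (homEmb g)) (stdSimplex.map a t) =
          stdSimplex.map (imageFace σ) (stdSimplex.map θ t) := fun a ha => by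
      rw [stdSimplex.map_comp_apply, stdSimplex.map_comp_apply]
      exact congrArg (stdSimplex.map · t) (funext ha)
    exact key _ fun i => (faceMap_homFace _ _).trans (congrArg homFace
      (map_lastHom σ (homOfLE (θ.toOrderHom.monotone (Fin.le_last i)))))

lemma simplexOf_eq (hf : ∀ (m : ℕ) (k : Fin (m + 1)) (i : Fin (m + 1) → I),
      f m (i ∘ k.succAbove) ≤ f (m + 1) i) {b : Finset I → ℕ → I} (hb : IsBound f b)
    {m : ℕ} (σ : ComposableArrows (MObj I f) m) :
    simplexOf (tupleFunctor hf hb (σ.obj (Fin.last m))) (fun i => faceLabels (imageFace σ i))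
      (faceLabels_mono.comp (imageFace_mono σ)) = σ := by
  let x := σ.obj (Fin.last m)
  let φ : ∀ i, σ.obj i ⟶ tupleObj hf hb x (faceLabels (imageFace σ i)) := fun i =>
    toTuple hf hb _ (fun v => vtx ((lastHom σ i).1 v))
      (fun v w h => vtx_lt_vtx.2 ((lastHom σ i).2.1 h))
      (fun v => Finset.mem_map_of_mem _ (Finset.mem_map_of_mem _ (Finset.mem_univ v)))
      fun v => (lastHom σ i).2.2 v
  have hφ : ∀ i v, tupleEmb hf hb x _ ((φ i).1 v) = vtx ((lastHom σ i).1 v) := fun i v =>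
    tupleEmb_toTuple ..
  refine (functor_eq (F := σ) (F' := Monotone.functor (faceLabels_mono.comp (imageFace_mono σ)) ⋙
      tupleFunctor hf hb x) { app := φ, naturality := fun i j h => ?_ } fun i => ?_).symm
  · refine tupleObj_hom_ext hf hb (faceLabels (imageFace σ j)) fun v => ?_
    refine ((hφ j _).trans (congrArg (fun g => vtx (g.1 v)) (map_lastHom σ h))).trans ?_
    exact ((tupleEmb_map hf hb x
      ((Monotone.functor (faceLabels_mono.comp (imageFace_mono σ))).map h) _).trans (hφ i v)).symm
  · change _ = ((Finset.univ.map _).map _).card - 1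
    simp

end Lift

section Operations

variable {X Y : Type} [Fintype X] [Fintype Y]

/-- The point dividing a segment in a standard simplex in a given ratio. -/
def simplexMix (s : unitInterval) (u v : stdSimplex ℝ X) : stdSimplex ℝ X :=
  ⟨fun x => (1 - s) * u x + s * v x,
    convex_stdSimplex ℝ X u.2 v.2 (sub_nonneg.2 s.2.2) s.2.1 (sub_add_cancel _ _)⟩

lemma simplexMix_apply (s : unitInterval) (u v : stdSimplex ℝ X) (x : X) :
    simplexMix s u v x = (1 - s) * u x + s * v x := rfl

lemma simplexMix_zero (u v : stdSimplex ℝ X) : simplexMix 0 u v = u := by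
  ext x
  simp [simplexMix_apply]

lemma simplexMix_one (u v : stdSimplex ℝ X) : simplexMix 1 u v = v := by
  ext x
  simp [simplexMix_apply]

lemma map_simplexMix (f : X → Y) (s : unitInterval) (u v : stdSimplex ℝ X) :
    stdSimplex.map f (simplexMix s u v) =
      simplexMix s (stdSimplex.map f u) (stdSimplex.map f v) := by
  classical
  ext y
  rw [simplexMix_apply, stdSimplex_map_apply, stdSimplex_map_apply, stdSimplex_map_apply,
    Finset.mul_sum, Finset.mul_sum, ← Finset.sum_add_distrib]
  rfl

variable {P P' : Type} [PartialOrder P] [Fintype P] [PartialOrder P'] [Fintype P']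

lemma ChainWeight.continuous_eval (p : P) : Continuous fun w : ChainWeight P => w.1 p :=
  (continuous_apply p).comp (continuous_subtype_val.comp continuous_subtype_val)

lemma ChainWeight.continuous_of_eval {Z : Type} [TopologicalSpace Z] {g : Z → ChainWeight P}
    (h : ∀ p, Continuous fun z => (g z).1 p) : Continuous g :=
  Continuous.subtype_mk (Continuous.subtype_mk (continuous_pi h) _) _

lemma ChainWeight.continuous_push (f : P → P') (hf : Monotone f) :
    Continuous (ChainWeight.push f hf) :=
  Continuous.subtype_mk ((stdSimplex.continuous_map f).comp continuous_subtype_val) _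

lemma ChainWeight.push_push {P'' : Type} [PartialOrder P''] [Fintype P''] (f : P → P')
    (hf : Monotone f) (g : P' → P'') (hg : Monotone g) (w : ChainWeight P) :
    (w.push f hf).push g hg = w.push (g ∘ f) (hg.comp hf) :=
  Subtype.ext (stdSimplex.map_comp_apply _ _ _)

lemma ChainWeight.push_congr {f g : P → P'} (hf : Monotone f) (hg : Monotone g)
    (h : ∀ p, f p = g p) (w : ChainWeight P) : w.push f hf = w.push g hg := by
  obtain rfl : f = g := funext h
  rfl

lemma ChainWeight.push_ne_zero {f : P → P'} {hf : Monotone f} {w : ChainWeight P} {q : P'}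
    (h : (w.push f hf).1 q ≠ 0) : ∃ p, f p = q ∧ w.1 p ≠ 0 :=
  (stdSimplex_map_ne_zero _ _ _).1 h

/-- The point dividing a segment in an order complex in a given ratio. -/
def ChainWeight.mix (s : unitInterval) (u v : ChainWeight P)
    (h : ∀ p q, u.1 p ≠ 0 → v.1 q ≠ 0 → p ≤ q ∨ q ≤ p) : ChainWeight P :=
  ⟨simplexMix s u.1 v.1, by
    have key : ∀ p, simplexMix s u.1 v.1 p ≠ 0 → u.1 p ≠ 0 ∨ v.1 p ≠ 0 := fun p hp => by
      by_contra! h'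
      exact hp (by rw [simplexMix_apply, h'.1, h'.2]; simp)
    intro p hp q hq _
    rcases key p hp with hp | hp <;> rcases key q hq with hq | hq
    · exact u.2.total hp hq
    · exact h p q hp hq
    · exact (h q p hq hp).symm
    · exact v.2.total hp hq⟩

lemma ChainWeight.continuous_mix {Z : Type} [TopologicalSpace Z] {s : Z → unitInterval}
    {u v : Z → ChainWeight P} (hs : Continuous s) (hu : Continuous u) (hv : Continuous v)
    (h : ∀ z p q, (u z).1 p ≠ 0 → (v z).1 q ≠ 0 → p ≤ q ∨ q ≤ p) :
    Continuous fun z => ChainWeight.mix (s z) (u z) (v z) (h z) := by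
  refine continuous_of_eval fun p => ?_
  have h1 := (continuous_eval p).comp hu
  have h2 := (continuous_eval p).comp hv
  have h3 : Continuous fun z => (s z : ℝ) := continuous_subtype_val.comp hs
  exact ((continuous_const.sub h3).mul h1).add (h3.mul h2)

/-- The point of an order complex given by a vertex. -/
noncomputable def ChainWeight.dirac (p : P) : ChainWeight P :=
  .ofSimplex (m := 0) (fun _ => p) monotone_const default

lemma ChainWeight.eq_of_dirac_ne_zero {p q : P} (h : (dirac p).1 q ≠ 0) : q = p := by
  obtain ⟨-, h, -⟩ := (stdSimplex_map_ne_zero _ _ _).1 h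
  exact h.symm

lemma ChainWeight.push_dirac (f : P → P') (hf : Monotone f) (p : P) :
    (dirac p).push f hf = dirac (f p) :=
  Subtype.ext (stdSimplex.map_comp_apply _ _ _)

lemma ChainWeight.eq_dirac {w : ChainWeight P} {p : P} (h : ∀ q, w.1 q ≠ 0 → q = p) :
    w = dirac p := by
  have key : ∀ w : ChainWeight P, (∀ q, w.1 q ≠ 0 → q = p) → w.1 p = 1 := fun w h => by
    rw [← stdSimplex.sum_eq_one w.1]
    exact (Finset.sum_eq_single p (fun q _ hq => by_contra fun h' => hq (h q h')) (by simp)).symm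
  apply Subtype.ext
  ext q
  by_cases hq : q = p
  · subst hq
    exact (key w h).trans (key _ fun _ => eq_of_dirac_ne_zero).symm
  · rw [not_imp_comm.1 (h q) hq, not_imp_comm.1 (eq_of_dirac_ne_zero) hq]

open Classical in
/-- The total weight strictly below a point. -/
noncomputable def below (w : stdSimplex ℝ P) (p : P) : ℝ := ∑ q, if q < p then w q else 0

lemma below_nonneg (w : stdSimplex ℝ P) (p : P) : 0 ≤ below w p :=
  Finset.sum_nonneg fun q _ => by
    split_ifs
    exacts [stdSimplex.zero_le _ _, le_rfl]

lemma below_add_le_below (w : stdSimplex ℝ P) {p q : P} (h : p < q) :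
    below w p + w p ≤ below w q := by
  classical
  have h1 : w p = ∑ r, if r = p then w r else 0 := by simp
  rw [h1, below, below, ← Finset.sum_add_distrib]
  refine Finset.sum_le_sum fun r _ => ?_
  have := stdSimplex.zero_le w r
  by_cases h2 : r = p
  · subst h2
    simp [h]
  · by_cases h3 : r < p
    · simp [h2, h3, h3.trans h]
    · simp only [h2, h3, if_false, add_zero]
      split_ifs
      exacts [this, le_rfl]

lemma below_add_le_one (w : stdSimplex ℝ P) (p : P) : below w p + w p ≤ 1 := by
  classical
  have h1 : w p = ∑ r, if r = p then w r else 0 := by simp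
  rw [h1, below, ← Finset.sum_add_distrib, ← stdSimplex.sum_eq_one w]
  refine Finset.sum_le_sum fun r _ => ?_
  have := stdSimplex.zero_le w r
  by_cases h2 : r = p
  · subst h2
    simp
  · simp only [h2, if_false, add_zero]
    split_ifs
    exacts [le_rfl, this]

lemma below_map (i : P ↪o P') (w : stdSimplex ℝ P) (p : P) :
    below (stdSimplex.map i w) (i p) = below w p := by
  classical
  symm
  refine Fintype.sum_of_injective i i.injective _ _ (fun q hq => ?_) fun q => ?_
  · rw [ite_eq_right_iff]
    intro _
    by_contra h
    obtain ⟨r, hr, -⟩ := (stdSimplex_map_ne_zero _ _ _).1 h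
    exact hq ⟨r, hr⟩
  · rw [stdSimplex_map_apply_injective i i.injective, i.lt_iff_lt]

/-- The part of the weight of `p` that lies in the lower portion of total weight `1 - s`. -/
noncomputable def lowPart (s : unitInterval) (w : stdSimplex ℝ P) (p : P) : ℝ :=
  min (below w p + w p) (1 - s) - min (below w p) (1 - s)

lemma lowPart_nonneg (s : unitInterval) (w : stdSimplex ℝ P) (p : P) : 0 ≤ lowPart s w p :=
  sub_nonneg.2 (min_le_min_right _ (le_add_of_nonneg_right (stdSimplex.zero_le w p)))

lemma lowPart_le (s : unitInterval) (w : stdSimplex ℝ P) (p : P) : lowPart s w p ≤ w p := by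
  have := stdSimplex.zero_le w p
  unfold lowPart
  rcases min_cases (below w p) (1 - s) with h | h <;>
    rcases min_cases (below w p + w p) (1 - s) with h' | h' <;> linarith

lemma le_of_parts_ne_zero {s : unitInterval} {w : stdSimplex ℝ P} {p q : P}
    (h : p ≤ q ∨ q ≤ p) (hp : lowPart s w p ≠ 0) (hq : w q - lowPart s w q ≠ 0) : p ≤ q := by
  refine h.elim id fun h => ?_
  by_contra hn
  have hlt := below_add_le_below w (lt_of_le_not_ge h hn)
  have hq0 := stdSimplex.zero_le w q
  have hp0 := stdSimplex.zero_le w p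
  have h1 : below w p < 1 - s := by
    by_contra! h1
    refine hp ?_
    rw [lowPart, min_eq_right h1, min_eq_right (by linarith), sub_self]
  refine hq ?_
  rw [lowPart, min_eq_left (by linarith), min_eq_left (by linarith)]
  ring

/-- The splitting of a weight function into its lower portion of total weight `1 - s`
and the remaining upper portion. -/
noncomputable def split (s : unitInterval) (w : ChainWeight P) : ChainWeight (P × Bool) :=
  ⟨⟨fun p => if p.2 then w.1 p.1 - lowPart s w.1 p.1 else lowPart s w.1 p.1, fun p => by
      dsimp only
      split_ifs
      exacts [sub_nonneg.2 (lowPart_le _ _ _), lowPart_nonneg _ _ _], by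
      rw [Fintype.sum_prod_type, ← stdSimplex.sum_eq_one w.1]
      simp⟩, by
    have key : ∀ p, lowPart s w.1 p ≠ 0 → w.1 p ≠ 0 := fun p hp h => hp
      (le_antisymm ((lowPart_le _ _ _).trans_eq h) (lowPart_nonneg _ _ _))
    have key' : ∀ p, w.1 p - lowPart s w.1 p ≠ 0 → w.1 p ≠ 0 := fun p hp h => hp (by
      rw [not_imp_comm.1 (key p) (not_not.2 h), h, sub_self])
    rintro ⟨p, _ | _⟩ hp ⟨q, _ | _⟩ hq _
    · change lowPart _ _ _ ≠ 0 at hp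
      change lowPart _ _ _ ≠ 0 at hq
      exact (w.2.total (key _ hp) (key _ hq)).imp (fun h => ⟨h, le_rfl⟩) fun h => ⟨h, le_rfl⟩
    · change lowPart _ _ _ ≠ 0 at hp
      change _ - lowPart _ _ _ ≠ 0 at hq
      exact .inl ⟨le_of_parts_ne_zero (w.2.total (key _ hp) (key' _ hq)) hp hq, Bool.false_le _⟩
    · change _ - lowPart _ _ _ ≠ 0 at hp
      change lowPart _ _ _ ≠ 0 at hq
      exact .inr ⟨le_of_parts_ne_zero (w.2.total (key _ hq) (key' _ hp)) hq hp, Bool.false_le _⟩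
    · change _ - lowPart _ _ _ ≠ 0 at hp
      change _ - lowPart _ _ _ ≠ 0 at hq
      exact (w.2.total (key' _ hp) (key' _ hq)).imp (fun h => ⟨h, le_rfl⟩) fun h => ⟨h, le_rfl⟩⟩

lemma split_apply (s : unitInterval) (w : ChainWeight P) (p : P × Bool) :
    (split s w).1 p = if p.2 then w.1 p.1 - lowPart s w.1 p.1 else lowPart s w.1 p.1 := rfl

lemma continuous_split :
    Continuous fun p : ChainWeight P × unitInterval => split p.2 p.1 := by
  classical
  have hw : ∀ q, Continuous fun p : ChainWeight P × unitInterval => p.1.1 q := fun q =>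
    (ChainWeight.continuous_eval q).comp continuous_fst
  have hb : ∀ q, Continuous fun p : ChainWeight P × unitInterval => below p.1.1 q := fun q => by
    refine continuous_finsetSum _ fun r _ => ?_
    split_ifs
    exacts [hw r, continuous_const]
  have hs : Continuous fun p : ChainWeight P × unitInterval => (1 - p.2 : ℝ) :=
    continuous_const.sub (continuous_subtype_val.comp continuous_snd)
  have hl : ∀ q, Continuous fun p : ChainWeight P × unitInterval => lowPart p.2 p.1.1 q :=
    fun q => (((hb q).add (hw q)).min hs).sub ((hb q).min hs)
  refine ChainWeight.continuous_of_eval fun q => ?_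
  simp only [split_apply]
  split_ifs
  exacts [(hw _).sub (hl _), hl _]

omit [Fintype P] in
lemma monotone_pair (c : Bool) : Monotone fun p : P => (p, c) := fun _ _ h => ⟨h, le_rfl⟩

lemma eq_push_pair {v : ChainWeight (P × Bool)} {w : ChainWeight P} {c : Bool}
    (h : ∀ p, v.1 (p, c) = w.1 p) (h0 : ∀ p, v.1 (p, !c) = 0) :
    v = w.push (fun p => (p, c)) (monotone_pair c) := by
  refine Subtype.ext (stdSimplex_eq_map_of_injective _ (Prod.mk_left_injective c) _ _ h
    fun q hq => ?_).symm
  obtain ⟨p, d⟩ := q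
  refine ⟨p, ?_⟩
  by_contra hd
  obtain rfl : d = !c := by
    cases c <;> cases d <;> simp_all
  exact hq (h0 p)

lemma split_zero (w : ChainWeight P) :
    split 0 w = w.push (fun p => (p, false)) (monotone_pair false) := by
  have key : ∀ p, lowPart 0 w.1 p = w.1 p := fun p => by
    have := below_add_le_one w.1 p
    have h0 := stdSimplex.zero_le w.1 p
    rw [lowPart, min_eq_left (by simpa using this), min_eq_left (by
      rw [Set.Icc.coe_zero]; linarith)]
    ring
  refine eq_push_pair (fun p => ?_) fun p => ?_
  · simp [split_apply, key]
  · simp [split_apply, key]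

lemma split_one (w : ChainWeight P) :
    split 1 w = w.push (fun p => (p, true)) (monotone_pair true) := by
  have key : ∀ p, lowPart 1 w.1 p = 0 := fun p => by
    have := below_nonneg w.1 p
    have h0 := stdSimplex.zero_le w.1 p
    rw [lowPart, Set.Icc.coe_one, sub_self, min_eq_right (by linarith), min_eq_right this,
      sub_self]
  refine eq_push_pair (fun p => ?_) fun p => ?_
  · simp [split_apply, key]
  · simp [split_apply, key]

lemma split_push (i : P ↪o P') (s : unitInterval) (w : ChainWeight P) :
    split s (w.push i i.monotone) =
      (split s w).push (Prod.map i id) (i.monotone.prodMap monotone_id) := by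
  have h1 := stdSimplex_map_apply_injective i i.injective w.1
  have key : ∀ p, lowPart s (stdSimplex.map i w.1) (i p) = lowPart s w.1 p := fun p => by
    rw [lowPart, lowPart, below_map, h1]
  refine Subtype.ext (stdSimplex_eq_map_of_injective _
    (i.injective.prodMap Function.injective_id) _ _ (fun p => ?_) fun q hq => ?_).symm
  · rw [split_apply, split_apply]
    change (if p.2 then stdSimplex.map i w.1 (i p.1) - lowPart s (stdSimplex.map i w.1) (i p.1)
      else lowPart s (stdSimplex.map i w.1) (i p.1)) = _
    rw [key, h1]
  · obtain ⟨q, c⟩ := q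
    have : (w.push i i.monotone).1 q ≠ 0 := fun h => by
      have hl : lowPart s (w.push i i.monotone).1 q = 0 :=
        le_antisymm ((lowPart_le _ _ _).trans_eq h) (lowPart_nonneg _ _ _)
      refine hq ?_
      rw [split_apply, h, hl]
      simp
    obtain ⟨p, rfl, -⟩ := ChainWeight.push_ne_zero this
    exact ⟨(p, c), rfl⟩

end Operations

section Subdivision

variable {N N' : ℕ}

/-- The order embedding on faces induced by an embedding of simplices. -/
def faceEmb (e : Fin N ↪o Fin N') : Face N ↪o Face N' :=
  OrderEmbedding.ofMapLEIff (faceMap e) fun _ _ => Finset.map_subset_map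

/-- The poset of low (`false`) nonempty and high (`true`) arbitrary sets of vertices. -/
abbrev Pre (N : ℕ) : Type := {q : Finset (Fin N) × Bool // q.2 = false → q.1.Nonempty}

/-- The order embedding on low and high sets induced by an embedding of simplices. -/
def preMap (e : Fin N ↪o Fin N') : Pre N ↪o Pre N' :=
  OrderEmbedding.ofMapLEIff
    (fun q => ⟨(q.1.1.map e.toEmbedding, q.1.2), fun h => (q.2 h).map⟩)
    fun _ _ => and_congr_left' Finset.map_subset_map

/-- A face together with a height, as a low or high set. -/
def inPre (q : Face N × Bool) : Pre N := ⟨(q.1.1, q.2), fun _ => q.1.2⟩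

lemma monotone_inPre : Monotone (inPre (N := N)) := fun _ _ h => h

/-- The high empty set. -/
def highEmpty (N : ℕ) : Pre N := ⟨(∅, true), fun h => absurd h (by simp)⟩

lemma preMap_highEmpty (e : Fin N ↪o Fin N') : preMap e (highEmpty N) = highEmpty N' :=
  Subtype.ext (Prod.ext (Finset.map_empty _) rfl)

/-- The labels of a low or high set: its vertices if it is low, its apex if it is high. -/
def preLabels (q : Pre N) : Finset (Label N) :=
  bif q.1.2 then {apex q.1.1} else q.1.1.map ⟨vtx, vtx_injective⟩

lemma vtx_mem_preLabels {q : Pre N} {v : Fin N} :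
    vtx v ∈ preLabels q ↔ q.1.2 = false ∧ v ∈ q.1.1 := by
  obtain ⟨⟨S, _ | _⟩, h⟩ := q
  · simp [preLabels]
  · simp [preLabels]

lemma apex_mem_preLabels {q : Pre N} {S : Finset (Fin N)} :
    apex S ∈ preLabels q ↔ q.1 = (S, true) := by
  obtain ⟨⟨S', _ | _⟩, h⟩ := q
  · simp [preLabels]
  · simp [preLabels, apex_injective.eq_iff, eq_comm]

lemma preLabels_nonempty (q : Pre N) : (preLabels q).Nonempty := by
  obtain ⟨⟨S, _ | _⟩, h⟩ := q
  · simpa [preLabels] using h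
  · simp [preLabels]

lemma preLabels_preMap (e : Fin N ↪o Fin N') (q : Pre N) :
    preLabels (preMap e q) = (preLabels q).map (labelMap e).toEmbedding := by
  obtain ⟨⟨S, _ | _⟩, h⟩ := q
  · change (S.map _).map _ = (S.map _).map _
    rw [Finset.map_map, Finset.map_map]
    rfl
  · change _ = Finset.map _ {_}
    rw [Finset.map_singleton]
    rfl

lemma not_high_le_low {q q' : Pre N} (h : q.1.2 = true) (h' : q'.1.2 = false) : ¬ q ≤ q' :=
  fun hle => by
    have : q.1.2 ≤ q'.1.2 := hle.2
    rw [h, h'] at this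
    exact absurd this (by decide)

open Classical in
/-- The set of all labels of the members of a chain of low and high sets. -/
noncomputable def chainLabels (B : Chains (Pre N)) : LabelSet N :=
  ⟨B.1.biUnion preLabels, B.2.1.biUnion fun q _ => preLabels_nonempty q, by
    intro v S hv hS
    obtain ⟨q, hq, hv⟩ := Finset.mem_biUnion.1 hv
    obtain ⟨q', hq', hS⟩ := Finset.mem_biUnion.1 hS
    rw [vtx_mem_preLabels] at hv
    rw [apex_mem_preLabels] at hS
    have := (B.2.2.total hq hq').resolve_right (not_high_le_low (by rw [hS]) hv.1)
    have h : q.1.1 ⊆ q'.1.1 := this.1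
    rw [hS] at h
    exact h hv.2, by
    intro S S' hS hS'
    obtain ⟨q, hq, hS⟩ := Finset.mem_biUnion.1 hS
    obtain ⟨q', hq', hS'⟩ := Finset.mem_biUnion.1 hS'
    rw [apex_mem_preLabels] at hS hS'
    refine (B.2.2.total hq hq').imp (fun h => ?_) fun h => ?_
    · have h : q.1.1 ⊆ q'.1.1 := h.1
      rwa [hS, hS'] at h
    · have h : q'.1.1 ⊆ q.1.1 := h.1
      rwa [hS, hS'] at h⟩

lemma mem_chainLabels {B : Chains (Pre N)} {l : Label N} :
    l ∈ (chainLabels B).1 ↔ ∃ q ∈ B.1, l ∈ preLabels q := by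
  classical
  exact Finset.mem_biUnion

lemma monotone_chainLabels : Monotone (chainLabels (N := N)) := by
  classical
  exact fun _ _ h => Finset.biUnion_subset_biUnion_of_subset_left _ h

lemma chainLabels_map (e : Fin N ↪o Fin N') (B : Chains (Pre N)) :
    chainLabels (Chains.map (preMap e) B) = (chainLabels B).map e := by
  apply Subtype.ext
  ext l
  rw [mem_chainLabels]
  simp only [LabelSet.map, Chains.map, Finset.mem_map, mem_chainLabels]
  constructor
  · rintro ⟨_, ⟨q, hq, rfl⟩, hl⟩
    replace hl : l ∈ preLabels (preMap e q) := hl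
    rw [preLabels_preMap] at hl
    obtain ⟨l, hl', rfl⟩ := Finset.mem_map.1 hl
    exact ⟨l, ⟨q, hq, hl'⟩, rfl⟩
  · rintro ⟨l, ⟨q, hq, hl⟩, rfl⟩
    refine ⟨_, ⟨q, hq, rfl⟩, ?_⟩
    change _ ∈ preLabels (preMap e q)
    rw [preLabels_preMap]
    exact Finset.mem_map_of_mem _ hl

/-- The labelling of a point of the barycentric subdivision of the order complex of `Pre N`. -/
noncomputable def subdivide (w : ChainWeight (Pre N)) : ChainWeight (LabelSet N) :=
  (barycentric w).push chainLabels monotone_chainLabels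

lemma continuous_subdivide : Continuous (subdivide (N := N)) :=
  (ChainWeight.continuous_push _ _).comp continuous_barycentric

lemma subdivide_push (e : Fin N ↪o Fin N') (w : ChainWeight (Pre N)) :
    subdivide (w.push (preMap e) (preMap e).monotone) =
      (subdivide w).push (LabelSet.map e) (LabelSet.monotone_map e) := by
  rw [subdivide, subdivide, barycentric_push, ChainWeight.push_push, ChainWeight.push_push]
  exact ChainWeight.push_congr _ _ (chainLabels_map e) _

/-- The set consisting of the apex of the empty set. -/
def emptyApex (N : ℕ) : LabelSet N := ⟨{apex ∅}, by simp, by simp, by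
  simp +contextual [apex_injective.eq_iff]⟩

lemma subdivide_highEmpty : subdivide (.dirac (highEmpty N)) = .dirac (emptyApex N) := by
  refine ChainWeight.eq_dirac fun A hA => ?_
  obtain ⟨B, rfl, hB⟩ := ChainWeight.push_ne_zero hA
  have hB' : ∀ q ∈ B.1, q = highEmpty N := fun q hq =>
    ChainWeight.eq_of_dirac_ne_zero (barycentric_ne_zero hB q hq)
  obtain ⟨q, hq⟩ := B.2.1
  apply Subtype.ext
  ext l
  rw [mem_chainLabels]
  constructor
  · rintro ⟨q, hq, hl⟩
    rwa [hB' q hq] at hl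
  · exact fun hl => ⟨q, hq, by rw [hB' q hq]; exact hl⟩

/-- The low copy of a weight function on faces. -/
noncomputable def low (w : ChainWeight (Face N)) : ChainWeight (Pre N) :=
  (w.push (fun p => (p, false)) (monotone_pair false)).push inPre monotone_inPre

/-- The high copy of a weight function on faces. -/
noncomputable def high (w : ChainWeight (Face N)) : ChainWeight (Pre N) :=
  (w.push (fun p => (p, true)) (monotone_pair true)).push inPre monotone_inPre

lemma continuous_low : Continuous (low (N := N)) :=
  (ChainWeight.continuous_push _ _).comp (ChainWeight.continuous_push _ _)

lemma continuous_high : Continuous (high (N := N)) :=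
  (ChainWeight.continuous_push _ _).comp (ChainWeight.continuous_push _ _)

lemma low_push (e : Fin N ↪o Fin N') (w : ChainWeight (Face N)) :
    low (w.push (faceMap e) (faceMap_mono e)) =
      (low w).push (preMap e) (preMap e).monotone := by
  simp only [low, ChainWeight.push_push]
  rfl

lemma high_push (e : Fin N ↪o Fin N') (w : ChainWeight (Face N)) :
    high (w.push (faceMap e) (faceMap_mono e)) =
      (high w).push (preMap e) (preMap e).monotone := by
  simp only [high, ChainWeight.push_push]
  rfl

lemma low_ne_zero {w : ChainWeight (Face N)} {q : Pre N} (h : (low w).1 q ≠ 0) :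
    ∃ S, w.1 S ≠ 0 ∧ q = inPre (S, false) := by
  obtain ⟨p, rfl, hp⟩ := ChainWeight.push_ne_zero h
  obtain ⟨S, rfl, hS⟩ := ChainWeight.push_ne_zero hp
  exact ⟨S, hS, rfl⟩

lemma high_ne_zero {w : ChainWeight (Face N)} {q : Pre N} (h : (high w).1 q ≠ 0) :
    q.1.2 = true := by
  obtain ⟨p, rfl, hp⟩ := ChainWeight.push_ne_zero h
  obtain ⟨S, rfl, hS⟩ := ChainWeight.push_ne_zero hp
  rfl

lemma faceLabels_comparable (w : ChainWeight (Face N)) (A A' : LabelSet N)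
    (hA : (w.push faceLabels faceLabels_mono).1 A ≠ 0) (hA' : (subdivide (low w)).1 A' ≠ 0) :
    A ≤ A' ∨ A' ≤ A := by
  obtain ⟨S, rfl, hS⟩ := ChainWeight.push_ne_zero hA
  obtain ⟨B, rfl, hB⟩ := ChainWeight.push_ne_zero hA'
  have hB' := fun q hq => low_ne_zero (barycentric_ne_zero hB q hq)
  by_cases h : ∃ q ∈ B.1, S.1 ⊆ q.1.1
  · obtain ⟨q, hq, h⟩ := h
    left
    intro l hl
    obtain ⟨v, hv, rfl⟩ := Finset.mem_map.1 hl
    obtain ⟨S', -, rfl⟩ := hB' q hq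
    exact mem_chainLabels.2 ⟨_, hq, vtx_mem_preLabels.2 ⟨rfl, h hv⟩⟩
  · right
    intro l hl
    obtain ⟨q, hq, hl⟩ := mem_chainLabels.1 hl
    obtain ⟨S', hS', rfl⟩ := hB' q hq
    have hle : S'.1 ⊆ S.1 := (w.2.total hS' hS).resolve_right fun h' => h ⟨_, hq, h'⟩
    obtain ⟨v, hv, rfl⟩ := Finset.mem_map.1 (show l ∈ S'.1.map ⟨vtx, vtx_injective⟩ from hl)
    exact Finset.mem_map_of_mem _ (hle hv)

lemma mix_push {P P' : Type} [PartialOrder P] [Fintype P] [PartialOrder P'] [Fintype P']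
    (f : P → P') (hf : Monotone f) (s : unitInterval) (u v : ChainWeight P)
    (h : ∀ p q, u.1 p ≠ 0 → v.1 q ≠ 0 → p ≤ q ∨ q ≤ p) (u' v' : ChainWeight P')
    (h' : ∀ p q, u'.1 p ≠ 0 → v'.1 q ≠ 0 → p ≤ q ∨ q ≤ p) (hu : u' = u.push f hf)
    (hv : v' = v.push f hf) : ChainWeight.mix s u' v' h' = (ChainWeight.mix s u v h).push f hf := by
  subst hu hv
  exact Subtype.ext (map_simplexMix f s _ _).symm

/-- The straight-line homotopy from the identity to the subdivision. -/
noncomputable def lowering (p : ChainWeight (Face N) × unitInterval) : ChainWeight (LabelSet N) :=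
  .mix p.2 (p.1.push faceLabels faceLabels_mono) (subdivide (low p.1)) (faceLabels_comparable p.1)

/-- The homotopy from the low to the high copy. -/
noncomputable def raising (p : ChainWeight (Face N) × unitInterval) : ChainWeight (LabelSet N) :=
  subdivide ((split p.2 p.1).push inPre monotone_inPre)

lemma high_comparable (w : ChainWeight (Face N)) (p q : Pre N) (hp : (high w).1 p ≠ 0)
    (hq : (ChainWeight.dirac (highEmpty N)).1 q ≠ 0) : p ≤ q ∨ q ≤ p := by
  obtain rfl := ChainWeight.eq_of_dirac_ne_zero hq
  exact .inr ⟨Finset.empty_subset _, (high_ne_zero hp).ge⟩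

/-- The straight-line homotopy from the high copy to the high empty set. -/
noncomputable def coning (p : ChainWeight (Face N) × unitInterval) : ChainWeight (LabelSet N) :=
  subdivide (.mix p.2 (high p.1) (.dirac (highEmpty N)) (high_comparable p.1))

lemma continuous_lowering : Continuous (lowering (N := N)) :=
  ChainWeight.continuous_mix continuous_snd
    ((ChainWeight.continuous_push _ _).comp continuous_fst)
    ((continuous_subdivide.comp continuous_low).comp continuous_fst) _

lemma continuous_raising : Continuous (raising (N := N)) :=
  continuous_subdivide.comp ((ChainWeight.continuous_push _ _).comp continuous_split)

lemma continuous_coning : Continuous (coning (N := N)) :=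
  continuous_subdivide.comp (ChainWeight.continuous_mix continuous_snd
    (continuous_high.comp continuous_fst) continuous_const _)

lemma lowering_push (e : Fin N ↪o Fin N') (w : ChainWeight (Face N)) (s : unitInterval) :
    lowering (w.push (faceMap e) (faceMap_mono e), s) =
      (lowering (w, s)).push (LabelSet.map e) (LabelSet.monotone_map e) := by
  refine mix_push _ _ _ _ _ _ _ _ _ ?_ ?_
  · simp only [ChainWeight.push_push]
    exact ChainWeight.push_congr _ _ (faceLabels_faceMap e) _
  · simp only [low_push, subdivide_push]

lemma raising_push (e : Fin N ↪o Fin N') (w : ChainWeight (Face N)) (s : unitInterval) :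
    raising (w.push (faceMap e) (faceMap_mono e), s) =
      (raising (w, s)).push (LabelSet.map e) (LabelSet.monotone_map e) := by
  refine Eq.trans (congrArg subdivide ?_) (subdivide_push e _)
  refine (congrArg (ChainWeight.push _ _) (split_push (faceEmb e) s w)).trans ?_
  rw [ChainWeight.push_push, ChainWeight.push_push]
  rfl

lemma coning_push (e : Fin N ↪o Fin N') (w : ChainWeight (Face N)) (s : unitInterval) :
    coning (w.push (faceMap e) (faceMap_mono e), s) =
      (coning (w, s)).push (LabelSet.map e) (LabelSet.monotone_map e) := by
  refine Eq.trans (congrArg subdivide ?_) (subdivide_push e _)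
  refine mix_push _ _ _ _ _ _ _ _ _ (high_push e w) ?_
  rw [ChainWeight.push_dirac, preMap_highEmpty]

lemma lowering_zero (w : ChainWeight (Face N)) :
    lowering (w, 0) = w.push faceLabels faceLabels_mono :=
  Subtype.ext (simplexMix_zero _ _)

lemma lowering_one (w : ChainWeight (Face N)) : lowering (w, 1) = subdivide (low w) :=
  Subtype.ext (simplexMix_one _ _)

lemma raising_zero (w : ChainWeight (Face N)) : raising (w, 0) = subdivide (low w) := by
  rw [raising, split_zero, low]

lemma raising_one (w : ChainWeight (Face N)) : raising (w, 1) = subdivide (high w) := by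
  rw [raising, split_one, high]

lemma coning_zero (w : ChainWeight (Face N)) : coning (w, 0) = subdivide (high w) :=
  congrArg subdivide (Subtype.ext (simplexMix_zero _ _))

lemma coning_one (w : ChainWeight (Face N)) : coning (w, 1) = .dirac (emptyApex N) :=
  (congrArg subdivide (Subtype.ext (simplexMix_one _ _))).trans subdivide_highEmpty

end Subdivision

section Contraction

variable {I : Type} [PartialOrder I] {f : (m : ℕ) → (Fin m → I) → I}

lemma homotopic_of_family {Y : Type} [TopologicalSpace Y]
    (H : ∀ x : MObj I f, C(ChainWeight (Face (x.n + 1)) × unitInterval, Y))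
    (hH : ∀ (x y : MObj I f) (g : x ⟶ y) (w : ChainWeight (Face (x.n + 1))) (s : unitInterval),
      H y (w.push (faceMap (homEmb g)) (faceMap_mono _), s) = H x (w, s))
    (u v : C(SSet.toTop.obj (nerve (MObj I f)), Y))
    (hu : ∀ (m : ℕ) (σ : ComposableArrows (MObj I f) m) (t : stdSimplex ℝ (Fin (m + 1))),
      u (charMap (nerve (MObj I f)) (m := m) σ t) =
        H (σ.obj (Fin.last m)) (.ofSimplex (imageFace σ) (imageFace_mono σ) t, 0))
    (hv : ∀ (m : ℕ) (σ : ComposableArrows (MObj I f) m) (t : stdSimplex ℝ (Fin (m + 1))),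
      v (charMap (nerve (MObj I f)) (m := m) σ t) =
        H (σ.obj (Fin.last m)) (.ofSimplex (imageFace σ) (imageFace_mono σ) t, 1)) :
    u.Homotopic v := by
  obtain ⟨U, hU⟩ := exists_lift C(unitInterval, Y) (fun x => (H x).curry)
    fun x y g w => ContinuousMap.ext (hH x y g w)
  have key : ∀ (s : unitInterval) (u' : C(SSet.toTop.obj (nerve (MObj I f)), Y)),
      (∀ (m : ℕ) (σ : ComposableArrows (MObj I f) m) (t : stdSimplex ℝ (Fin (m + 1))),
        u' (charMap (nerve (MObj I f)) (m := m) σ t) =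
          H (σ.obj (Fin.last m)) (.ofSimplex (imageFace σ) (imageFace_mono σ) t, s)) →
      ∀ z, U z s = u' z := fun s u' hu' z => by
    refine DFunLike.congr_fun (realization_ext (nerve (MObj I f)) Y
      ⟨fun z => U z s, (ContinuousEvalConst.continuous_eval_const s).comp U.continuous⟩ u'
      fun m σ t => ?_) z
    exact (DFunLike.congr_fun (hU m σ t) s).trans (hu' m σ t).symm
  exact ⟨{ toContinuousMap := U.uncurry.comp ContinuousMap.prodSwap
           map_zero_left := key 0 u hu
           map_one_left := key 1 v hv }⟩

variable (hf : ∀ (m : ℕ) (k : Fin (m + 1)) (i : Fin (m + 1) → I),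
      f m (i ∘ k.succAbove) ≤ f (m + 1) i)
  {b : Finset I → ℕ → I} (hb : IsBound f b)

lemma realizeFun_tupleFunctor_push {x y : MObj I f} (g : x ⟶ y)
    (w : ChainWeight (LabelSet (x.n + 1))) :
    realizeFun (tupleFunctor hf hb y)
        (w.push (LabelSet.map (homEmb g)) (LabelSet.monotone_map (homEmb g))) =
      realizeFun (tupleFunctor hf hb x) w := by
  rw [realizeFun_push, tupleFunctor_map]

lemma exists_realization (k : ∀ N, ChainWeight (Face N) → ChainWeight (LabelSet N))
    (hk : ∀ N, Continuous (k N))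
    (hk' : ∀ (N N' : ℕ) (e : Fin N ↪o Fin N') (w : ChainWeight (Face N)),
      k N' (w.push (faceMap e) (faceMap_mono e)) =
        (k N w).push (LabelSet.map e) (LabelSet.monotone_map e)) :
    ∃ u : C(SSet.toTop.obj (nerve (MObj I f)), SSet.toTop.obj (nerve (MObj I f))),
      ∀ (m : ℕ) (σ : ComposableArrows (MObj I f) m) (t : stdSimplex ℝ (Fin (m + 1))),
        u (charMap (nerve (MObj I f)) (m := m) σ t) =
          realizeFun (tupleFunctor hf hb (σ.obj (Fin.last m)))
            (k _ (.ofSimplex (imageFace σ) (imageFace_mono σ) t)) :=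
  exists_lift (SSet.toTop.obj (nerve (MObj I f)))
    (fun x => ⟨fun w => realizeFun (tupleFunctor hf hb x) (k _ w),
      (continuous_realizeFun _).comp (hk _)⟩)
    fun _ _ g w => (congrArg _ (hk' _ _ (homEmb g) w)).trans
      (realizeFun_tupleFunctor_push hf hb g _)

lemma homotopic_of_natural
    (K : ∀ N, ChainWeight (Face N) × unitInterval → ChainWeight (LabelSet N))
    (hK : ∀ N, Continuous (K N))
    (hK' : ∀ (N N' : ℕ) (e : Fin N ↪o Fin N') (w : ChainWeight (Face N)) (s : unitInterval),
      K N' (w.push (faceMap e) (faceMap_mono e), s) =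
        (K N (w, s)).push (LabelSet.map e) (LabelSet.monotone_map e))
    (u v : C(SSet.toTop.obj (nerve (MObj I f)), SSet.toTop.obj (nerve (MObj I f))))
    (hu : ∀ (m : ℕ) (σ : ComposableArrows (MObj I f) m) (t : stdSimplex ℝ (Fin (m + 1))),
      u (charMap (nerve (MObj I f)) (m := m) σ t) =
        realizeFun (tupleFunctor hf hb (σ.obj (Fin.last m)))
          (K _ (.ofSimplex (imageFace σ) (imageFace_mono σ) t, 0)))
    (hv : ∀ (m : ℕ) (σ : ComposableArrows (MObj I f) m) (t : stdSimplex ℝ (Fin (m + 1))),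
      v (charMap (nerve (MObj I f)) (m := m) σ t) =
        realizeFun (tupleFunctor hf hb (σ.obj (Fin.last m)))
          (K _ (.ofSimplex (imageFace σ) (imageFace_mono σ) t, 1))) :
    u.Homotopic v :=
  homotopic_of_family
    (fun x => ⟨fun p => realizeFun (tupleFunctor hf hb x) (K _ p),
      (continuous_realizeFun _).comp (hK _)⟩)
    (fun _ _ g w s => (congrArg _ (hK' _ _ (homEmb g) w s)).trans
      (realizeFun_tupleFunctor_push hf hb g _)) u v hu hv

lemma charMap_eq_realizeFun {m : ℕ} (σ : ComposableArrows (MObj I f) m)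
    (t : stdSimplex ℝ (Fin (m + 1))) :
    charMap (nerve (MObj I f)) (m := m) σ t =
      realizeFun (tupleFunctor hf hb (σ.obj (Fin.last m)))
        ((ChainWeight.ofSimplex (imageFace σ) (imageFace_mono σ) t).push
          faceLabels faceLabels_mono) := by
  have h : (ChainWeight.ofSimplex (imageFace σ) (imageFace_mono σ) t).push
      faceLabels faceLabels_mono = .ofSimplex (fun i => faceLabels (imageFace σ i))
        (faceLabels_mono.comp (imageFace_mono σ)) t :=
    Subtype.ext (stdSimplex.map_comp_apply _ _ _)
  rw [h, realizeFun_ofSimplex, simplexOf_eq]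

lemma realizeFun_emptyApex (x y : MObj I f) :
    realizeFun (tupleFunctor hf hb x) (.dirac (emptyApex (x.n + 1))) =
      realizeFun (tupleFunctor hf hb y) (.dirac (emptyApex (y.n + 1))) := by
  rw [ChainWeight.dirac, ChainWeight.dirac, realizeFun_ofSimplex, realizeFun_ofSimplex]
  let g : tupleObj hf hb x (emptyApex (x.n + 1)) ⟶ tupleObj hf hb y (emptyApex (y.n + 1)) :=
    toTuple hf hb _ (fun _ => apex ∅)
      (haveI : Subsingleton (Fin ((tupleObj hf hb x (emptyApex (x.n + 1))).n + 1)) := by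
        change Subsingleton (Fin 1)
        infer_instance
      Subsingleton.strictMono _)
      (fun _ => Finset.mem_singleton_self _) fun m => by
        rw [tupleObj_seq, Finset.mem_singleton.1 (tupleEmb_mem hf hb x (emptyApex (x.n + 1)) m)]
        rfl
  obtain ⟨e, -⟩ := exists_eqToHom g rfl
  have : simplexOf (tupleFunctor hf hb x) (m := 0) (fun _ => emptyApex (x.n + 1)) monotone_const =
      simplexOf (tupleFunctor hf hb y) (m := 0) (fun _ => emptyApex (y.n + 1)) monotone_const :=
    ComposableArrows.ext₀ e
  rw [this]

end Contraction

theorem M_weakly_contractible (I : Type) [PartialOrder I] [Nonempty I]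
    (hdir : ∀ S : Finset I, ∃ ub : I, ∀ x ∈ S, x ≤ ub)
    (f : (m : ℕ) → (Fin m → I) → I)
    (hf : ∀ (m : ℕ) (k : Fin (m + 1)) (i : Fin (m + 1) → I),
      f m (i ∘ k.succAbove) ≤ f (m + 1) i) :
    ContractibleSpace (SSet.toTop.obj (nerve (MObj I f))) := by
  choose b hb using fun E N => exists_bound (f := f) hdir E N
  replace hb : IsBound f b := hb
  let x₀ : MObj I f :=
    { n := 0
      seq := fun _ => f 0 Fin.elim0
      cond := fun k => by
        obtain rfl : k = 0 := Subsingleton.elim (α := Fin 1) _ _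
        exact (congrArg (f 0) (Subsingleton.elim _ _)).le }
  obtain ⟨u, hu⟩ := exists_realization hf hb (fun N w => subdivide (low w))
    (fun N => continuous_subdivide.comp continuous_low)
    fun N N' e w => by rw [low_push, subdivide_push]
  obtain ⟨v, hv⟩ := exists_realization hf hb (fun N w => subdivide (high w))
    (fun N => continuous_subdivide.comp continuous_high)
    fun N N' e w => by rw [high_push, subdivide_push]
  refine (contractible_iff_id_nullhomotopic _).2
    ⟨realizeFun (tupleFunctor hf hb x₀) (.dirac (emptyApex _)), ?_⟩
  refine ContinuousMap.Homotopic.trans (g := u) ?_ (ContinuousMap.Homotopic.trans (g := v) ?_ ?_)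
  · refine homotopic_of_natural hf hb (fun _ => lowering) (fun _ => continuous_lowering)
      (fun _ _ => lowering_push) _ _ (fun m σ t => ?_) fun m σ t => ?_
    · rw [lowering_zero]
      exact charMap_eq_realizeFun hf hb σ t
    · rw [lowering_one]
      exact hu m σ t
  · refine homotopic_of_natural hf hb (fun _ => raising) (fun _ => continuous_raising)
      (fun _ _ => raising_push) _ _ (fun m σ t => ?_) fun m σ t => ?_
    · rw [raising_zero]
      exact hu m σ t
    · rw [raising_one]
      exact hv m σ t
  · refine homotopic_of_natural hf hb (fun _ => coning) (fun _ => continuous_coning)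
      (fun _ _ => coning_push) _ _ (fun m σ t => ?_) fun m σ t => ?_
    · rw [coning_zero]
      exact hv m σ t
    · rw [coning_one]
      exact realizeFun_emptyApex hf hb _ _

end Reflection
end
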